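/- arXiv:1909.08301 — 3 statements merged into one kernel-verified Lean document; each statement's English description precedes it below -/
import Mathlib

section
/- Let L(s) = Σ_{n≥1} a(n) n^{-s} be a Dirichlet series satisfying hypotheses (I), (II), (III). Then the function s ↦ L(s) + L(2s) has infinitely many zeros in the half-plane Re(s) > 1; that is, the set {s ∈ ℂ : Re(s) > 1 and L(s) + L(2s) = 0} is infinite. -/
open Complex Filter

theorem tendsto_ofReal_inv_atTop : Tendsto (fun T : ℝ => (T : ℂ)⁻¹) atTop (nhds 0) :=
  tendsto_inv₀_cobounded.comp (RCLike.tendsto_ofReal_atTop_cobounded ℂ)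

/-- **Weyl equidistribution** for a linear flow on the torus with rationally independent
frequencies: time averages converge to the space average. -/
theorem tendsto_timeAverage_torus {ι : Type*} [Fintype ι] (c : ι → ℝ)
    (hc : ∀ m : ι → ℤ, ∑ i, (m i : ℝ) * c i = 0 → m = 0) (φ : C(UnitAddTorus ι, ℂ)) :
    Tendsto (fun T : ℝ => (T : ℂ)⁻¹ *
        ∫ t in (0 : ℝ)..T, φ (fun i => ((c i * t : ℝ) : UnitAddCircle)))
      atTop (nhds (∫ x, φ x)) := by
  have : MeasureTheory.IsProbabilityMeasure
      (MeasureTheory.volume : MeasureTheory.Measure UnitAddCircle) := ⟨by simp⟩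
  set flow : ℝ → UnitAddTorus ι := fun t i => ((c i * t : ℝ) : UnitAddCircle) with hflow
  have hflowc : Continuous flow := by
    refine continuous_pi fun i => ?_
    exact (AddCircle.continuous_mk' (p := (1 : ℝ))).comp (by fun_prop)
  have hint : ∀ (ψ : C(UnitAddTorus ι, ℂ)) (T : ℝ),
      IntervalIntegrable (fun t => ψ (flow t)) MeasureTheory.volume 0 T := fun ψ T =>
    (ψ.continuous.comp hflowc).intervalIntegrable _ _
  have hint' : ∀ ψ : C(UnitAddTorus ι, ℂ), MeasureTheory.Integrable (fun x => ψ x) := fun ψ =>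
    ψ.continuous.integrable_of_hasCompactSupport (HasCompactSupport.of_compactSpace _)
  have hspan : ∀ ψ ∈ Submodule.span ℂ (Set.range (UnitAddTorus.mFourier (d := ι))),
      Tendsto (fun T : ℝ => (T : ℂ)⁻¹ * ∫ t in (0 : ℝ)..T, ψ (flow t)) atTop
        (nhds (∫ x, ψ x)) := by
    intro ψ hψ
    induction hψ using Submodule.span_induction with
    | mem ψ h =>
      obtain ⟨n, rfl⟩ := h
      by_cases hn : n = 0
      · subst hn
        simp only [UnitAddTorus.mFourier_zero, ContinuousMap.one_apply]
        rw [MeasureTheory.integral_const]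
        simp only [MeasureTheory.probReal_univ, one_smul]
        refine tendsto_const_nhds.congr' ?_
        filter_upwards [eventually_gt_atTop 0] with T hT
        have : (T : ℂ) ≠ 0 := by exact_mod_cast hT.ne'
        simp [this]
      · have h0 : ∫ x, UnitAddTorus.mFourier n x = 0 := by
          simp only [UnitAddTorus.mFourier, ContinuousMap.coe_mk]
          rw [MeasureTheory.integral_fintype_prod_volume_eq_prod]
          obtain ⟨i, hi⟩ := Function.ne_iff.mp hn
          exact Finset.prod_eq_zero (Finset.mem_univ i)
            (MeasureTheory.integral_eq_zero_of_add_right_eq_neg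
              fun y => fourier_add_half_inv_index hi one_pos y)
        rw [h0]
        set w : ℝ := ∑ i, (n i : ℝ) * c i
        have hw : w ≠ 0 := fun h => hn (hc n h)
        have hform : ∀ t : ℝ, UnitAddTorus.mFourier n (flow t)
            = Complex.exp ((2 * Real.pi * w * I : ℂ) * t) := by
          intro t
          simp only [UnitAddTorus.mFourier, ContinuousMap.coe_mk, hflow, fourier_coe_apply]
          rw [← Complex.exp_sum]
          congr 1
          simp only [w]
          push_cast
          simp only [Finset.mul_sum, Finset.sum_mul]
          refine Finset.sum_congr rfl fun i _ => ?_
          ring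
        have hcne : (2 * Real.pi * w * I : ℂ) ≠ 0 := by
          simp [hw, Real.pi_ne_zero]
        simp only [hform, integral_exp_mul_complex hcne]
        refine tendsto_ofReal_inv_atTop.zero_mul_isBoundedUnder_le
          (isBoundedUnder_of ⟨2 / ‖(2 * Real.pi * w * I : ℂ)‖, fun T => ?_⟩)
        simp only [Function.comp_apply, norm_div]
        gcongr
        refine (norm_sub_le _ _).trans ?_
        have h1 : ∀ t : ℝ, ‖cexp (2 * Real.pi * w * I * t)‖ = 1 := fun t => by
          rw [← norm_exp_ofReal_mul_I (2 * Real.pi * w * t)]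
          congr 2
          push_cast
          ring
        rw [h1 T, h1 0]
        norm_num
    | zero => simp
    | add ψ₁ ψ₂ _ _ h₁ h₂ =>
      simp only [ContinuousMap.add_apply]
      rw [MeasureTheory.integral_add (hint' _) (hint' _)]
      refine (h₁.add h₂).congr fun T => ?_
      rw [intervalIntegral.integral_add (hint _ _) (hint _ _), mul_add]
    | smul a ψ _ h =>
      simp only [ContinuousMap.smul_apply, smul_eq_mul]
      rw [MeasureTheory.integral_const_mul]
      refine (h.const_mul a).congr fun T => ?_
      rw [intervalIntegral.integral_const_mul]
      ring
  rw [Metric.tendsto_nhds]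
  intro ε hε
  have hφ : φ ∈ (Submodule.span ℂ
      (Set.range (UnitAddTorus.mFourier (d := ι)))).topologicalClosure := by
    rw [UnitAddTorus.span_mFourier_closure_eq_top]; trivial
  obtain ⟨ψ, hψ, hd⟩ := Metric.mem_closure_iff.1 hφ (ε / 3) (by positivity)
  have hpt : ∀ x, ‖φ x - ψ x‖ ≤ ε / 3 := fun x => by
    rw [← dist_eq_norm]
    exact (ContinuousMap.dist_apply_le_dist x).trans hd.le
  filter_upwards [Metric.tendsto_nhds.1 (hspan ψ hψ) (ε / 3) (by positivity),
    eventually_gt_atTop 0] with T hT hT0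
  have h1 : ‖(T : ℂ)⁻¹ * (∫ t in (0 : ℝ)..T, φ (flow t))
      - (T : ℂ)⁻¹ * ∫ t in (0 : ℝ)..T, ψ (flow t)‖ ≤ ε / 3 := by
    rw [← mul_sub, ← intervalIntegral.integral_sub (hint _ _) (hint _ _), norm_mul, norm_inv,
      Complex.norm_real, Real.norm_of_nonneg hT0.le]
    have := intervalIntegral.norm_integral_le_of_norm_le_const (a := 0) (b := T)
      (f := fun t => φ (flow t) - ψ (flow t)) (C := ε / 3) fun t _ => hpt _
    rw [sub_zero, abs_of_pos hT0] at this
    rw [inv_mul_le_iff₀ hT0]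
    linarith
  have h2 : ‖(∫ x, ψ x) - ∫ x, φ x‖ ≤ ε / 3 := by
    rw [← MeasureTheory.integral_sub (hint' _) (hint' _)]
    have := MeasureTheory.norm_integral_le_of_norm_le_const
      (μ := (MeasureTheory.volume : MeasureTheory.Measure (UnitAddTorus ι)))
      (f := fun x => ψ x - φ x) (C := ε / 3)
      (Eventually.of_forall fun x => by rw [norm_sub_rev]; exact hpt x)
    simpa using this
  rw [dist_eq_norm] at hT ⊢
  calc _ = ‖((T : ℂ)⁻¹ * (∫ t in (0 : ℝ)..T, φ (flow t))
      - (T : ℂ)⁻¹ * ∫ t in (0 : ℝ)..T, ψ (flow t)) + (((T : ℂ)⁻¹ * ∫ t in (0 : ℝ)..T, ψ (flow t))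
      - ∫ x, ψ x) + ((∫ x, ψ x) - ∫ x, φ x)‖ := by congr 1; ring
    _ ≤ _ := norm_add₃_le
    _ < ε := by linarith

/-- **Kronecker's theorem** for linear flows. -/
theorem mapClusterPt_torus_flow {ι : Type*} [Fintype ι] (c : ι → ℝ)
    (hc : ∀ m : ι → ℤ, ∑ i, (m i : ℝ) * c i = 0 → m = 0) (x : UnitAddTorus ι) :
    MapClusterPt x atTop (fun (t : ℝ) (i : ι) => ((c i * t : ℝ) : UnitAddCircle)) := by
  rw [mapClusterPt_iff_frequently]
  intro s hs hfr
  obtain ⟨U, hUs, hUo, hxU⟩ := mem_nhds_iff.1 hs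
  obtain ⟨t₀, ht₀⟩ := eventually_atTop.1 hfr
  obtain ⟨f, hf0, hf1, hf⟩ := exists_continuous_zero_one_of_isClosed hUo.isClosed_compl
    (isClosed_singleton (x := x)) (by simpa using hxU)
  set flow : ℝ → UnitAddTorus ι := fun t i => ((c i * t : ℝ) : UnitAddCircle) with hflow
  have hflowc : Continuous flow := by
    refine continuous_pi fun i => ?_
    exact (AddCircle.continuous_mk' (p := (1 : ℝ))).comp (by fun_prop)
  have hlim := tendsto_timeAverage_torus c hc ⟨fun y => (f y : ℂ), by fun_prop⟩
  have hpos : 0 < ∫ y, f y := by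
    refine f.continuous.integral_pos_of_hasCompactSupport_nonneg_nonzero (x := x)
      (HasCompactSupport.of_compactSpace _) (fun y => (hf y).1) ?_
    rw [hf1 rfl]
    simp
  have hzero : Tendsto (fun T : ℝ => (T : ℂ)⁻¹ * ∫ t in (0 : ℝ)..T, (f (flow t) : ℂ)) atTop
      (nhds 0) := by
    have := tendsto_ofReal_inv_atTop.mul_const (∫ t in (0 : ℝ)..t₀, (f (flow t) : ℂ))
    rw [zero_mul] at this
    refine this.congr' ?_
    filter_upwards [eventually_ge_atTop t₀] with T hT
    have hi : ∀ u v : ℝ, IntervalIntegrable (fun t => (f (flow t) : ℂ)) MeasureTheory.volume u v :=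
      fun u v => Continuous.intervalIntegrable (by fun_prop) _ _
    rw [← intervalIntegral.integral_add_adjacent_intervals (hi 0 t₀) (hi t₀ T)]
    have : ∫ t in t₀..T, (f (flow t) : ℂ) = 0 := by
      rw [intervalIntegral.integral_congr (g := fun _ => 0)]
      · simp
      · intro t ht
        rw [Set.uIcc_of_le hT] at ht
        have : f (flow t) = 0 := hf0 fun h => ht₀ t ht.1 (hUs h)
        simp [this]
    rw [this, add_zero]
  have := tendsto_nhds_unique hlim hzero
  simp only [ContinuousMap.coe_mk] at this
  rw [integral_complex_ofReal] at this
  exact hpos.ne' (by exact_mod_cast this)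

/-- The logarithms of distinct primes are linearly independent over `ℤ`. -/
theorem eq_zero_of_sum_mul_log_prime_eq_zero {ι : Type*} [Fintype ι] (p : ι → ℕ)
    (hp : ∀ i, (p i).Prime) (hinj : Function.Injective p) (m : ι → ℤ)
    (h : ∑ i, (m i : ℝ) * Real.log (p i) = 0) : m = 0 := by
  classical
  have hpos : ∀ i, (0 : ℝ) < p i := fun i => by exact_mod_cast (hp i).pos
  have hfac : ∀ (k : ι → ℕ) (j : ι), (∏ i, p i ^ k i).factorization (p j) = k j := by
    intro k j
    rw [Nat.factorization_prod fun i _ => pow_ne_zero _ (hp i).ne_zero, Finsupp.finsetSum_apply,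
      Finset.sum_eq_single j]
    · simp [(hp j).factorization_pow]
    · intro i _ hij
      rw [(hp i).factorization_pow, Finsupp.single_apply, if_neg (hinj.ne hij)]
    · simp
  have hlog : ∀ k : ι → ℕ, Real.log ((∏ i, p i ^ k i : ℕ) : ℝ) = ∑ i, (k i : ℝ) * Real.log (p i) := by
    intro k
    push_cast
    rw [Real.log_prod fun i _ => (pow_pos (hpos i) _).ne']
    simp
  have hm : ∀ i, (m i : ℝ) = ((m i).toNat : ℝ) - ((-m i).toNat : ℝ) := fun i => by
    exact_mod_cast (Int.toNat_sub_toNat_neg (m i)).symm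
  have heq : ∏ i, p i ^ (m i).toNat = ∏ i, p i ^ (-m i).toNat := by
    have hp0 : ∀ k : ι → ℕ, (0 : ℝ) < ((∏ i, p i ^ k i : ℕ) : ℝ) := fun k => by
      exact_mod_cast Finset.prod_pos fun i _ => pow_pos (hp i).pos _
    have : Real.log ((∏ i, p i ^ (m i).toNat : ℕ) : ℝ)
        = Real.log ((∏ i, p i ^ (-m i).toNat : ℕ) : ℝ) := by
      rw [hlog, hlog, ← sub_eq_zero, ← Finset.sum_sub_distrib, ← h]
      exact Finset.sum_congr rfl fun i _ => by rw [hm i]; ring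
    exact_mod_cast Real.log_injOn_pos (hp0 _) (hp0 _) this
  funext j
  have := hfac (fun i => (m i).toNat) j
  rw [heq, hfac] at this
  simp only [Pi.zero_apply]
  omega

/-- The twists `p ^ (-it)` are dense in the infinite torus indexed by the primes, even along
`t → ∞`. -/
theorem mapClusterPt_prime_twist (χ : Nat.Primes → ℂ) (hχ : ∀ p, ‖χ p‖ = 1) :
    MapClusterPt χ atTop (fun (t : ℝ) (p : Nat.Primes) => ((p : ℕ) : ℂ) ^ (-((t : ℂ) * I))) := by
  rw [mapClusterPt_iff_frequently]
  intro s hs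
  rw [nhds_pi, Filter.mem_pi'] at hs
  obtain ⟨J, v, hv, hvs⟩ := hs
  have hcl := mapClusterPt_torus_flow (ι := J)
    (fun p => -Real.log ((p : Nat.Primes) : ℕ) / (2 * Real.pi)) (fun m hm => by
      refine eq_zero_of_sum_mul_log_prime_eq_zero (fun p : J => ((p : Nat.Primes) : ℕ))
        (fun p => p.1.2) (fun p q h => Subtype.ext (Subtype.ext h)) m ?_
      have : ∑ i : J, (m i : ℝ) * Real.log ((i : Nat.Primes) : ℕ) = -(2 * Real.pi) *
          ∑ i : J, (m i : ℝ) * (-Real.log ((i : Nat.Primes) : ℕ) / (2 * Real.pi)) := by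
        rw [Finset.mul_sum]
        exact Finset.sum_congr rfl fun i _ => by field_simp
      rw [this, hm, mul_zero])
    (fun p => ((arg (χ p) / (2 * Real.pi) : ℝ) : UnitAddCircle))
  have hcircle : ∀ u : ℝ, fourier 1 (u : UnitAddCircle) = cexp (2 * Real.pi * I * u) := fun u => by
    rw [fourier_coe_apply]
    simp
  have hmem : ∀ᶠ y : UnitAddTorus J in
      nhds (fun p : J => ((arg (χ p) / (2 * Real.pi) : ℝ) : UnitAddCircle)),
      ∀ p : J, fourier 1 (y p) ∈ v p := by
    refine eventually_all.2 fun p => ?_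
    have hc : Continuous fun y : UnitAddTorus J => (fourier 1 (y p) : ℂ) := by fun_prop
    refine hc.continuousAt.eventually ?_
    have : (fourier 1 ((arg (χ p) / (2 * Real.pi) : ℝ) : UnitAddCircle) : ℂ) = χ p := by
      rw [hcircle]
      conv_rhs => rw [← norm_mul_exp_arg_mul_I (χ p), hχ]
      rw [ofReal_one, one_mul]
      congr 1
      push_cast
      field_simp
    simp only [this]
    exact hv p
  refine (hcl.frequently hmem).mono fun t ht => hvs ?_
  intro p hp
  have := ht ⟨p, hp⟩
  convert this using 1
  have hp0 : ((p : ℕ) : ℂ) ≠ 0 := by exact_mod_cast p.2.ne_zero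
  simp only [hcircle, cpow_def_of_ne_zero hp0, ← natCast_log]
  congr 1
  push_cast
  field_simp

/-- If a Dirichlet series is the exponential of a Dirichlet series supported on prime powers, then
its coefficient at a prime is the corresponding coefficient of the logarithm, up to the factor
`a 1`. -/
theorem coeff_prime_eq_mul_of_exp_eq (a : ℕ → ℂ) (b : ℕ → ℕ → ℂ)
    (ha : ∀ s : ℂ, 1 < s.re → LSeriesSummable a s)
    (hsum : ∀ s : ℂ, 1 < s.re → Summable (fun pk : Nat.Primes × ℕ =>
        b pk.1 (pk.2 + 1) * (((pk.1 : ℕ) : ℂ) ^ (-s)) ^ (pk.2 + 1)))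
    (hexp : ∀ s : ℂ, 1 < s.re → cexp (∑' pk : Nat.Primes × ℕ,
        b pk.1 (pk.2 + 1) * (((pk.1 : ℕ) : ℂ) ^ (-s)) ^ (pk.2 + 1)) = LSeries a s)
    (p : Nat.Primes) : a p = a 1 * b p 1 := by
  set i : Nat.Primes × ℕ → ℕ := fun pk => (Nat.Primes.prodNatEquiv pk : ℕ) with hi
  have hinj : Function.Injective i := Subtype.val_injective.comp (Equiv.injective _)
  set B : ℕ → ℂ := Function.extend i (fun pk => b pk.1 (pk.2 + 1)) 0 with hB
  have hterm : ∀ (s : ℂ) (pk : Nat.Primes × ℕ), LSeries.term B s (i pk)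
      = b pk.1 (pk.2 + 1) * (((pk.1 : ℕ) : ℂ) ^ (-s)) ^ (pk.2 + 1) := by
    rintro s ⟨q, k⟩
    have hne : i (q, k) ≠ 0 := pow_ne_zero _ q.2.ne_zero
    rw [LSeries.term_of_ne_zero hne, hB, hinj.extend_apply, div_eq_mul_inv, ← cpow_neg]
    congr 1
    have : ∀ n : ℕ, (((q : ℕ) ^ n : ℕ) : ℂ) ^ (-s) = (((q : ℕ) : ℂ) ^ (-s)) ^ n := by
      intro n
      induction n with
      | zero => simp
      | succ n ih =>
        rw [pow_succ, Nat.cast_mul, natCast_mul_natCast_cpow, ih, pow_succ]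
    exact this (k + 1)
  have hsupp : ∀ (s : ℂ), ∀ n ∉ Set.range i, LSeries.term B s n = 0 := by
    intro s n hn
    have : B n = 0 := by
      rw [hB, Function.extend_apply' _ _ _ (by simpa using hn)]
      rfl
    rw [LSeries.term_def, this]
    simp
  have hBsum : ∀ s : ℂ, 1 < s.re → LSeriesSummable B s := fun s hs => by
    refine (hinj.summable_iff (hsupp s)).1 ?_
    exact (hsum s hs).congr fun pk => (hterm s pk).symm
  have hBtsum : ∀ s : ℂ, LSeries B s = ∑' pk : Nat.Primes × ℕ,
      b pk.1 (pk.2 + 1) * (((pk.1 : ℕ) : ℂ) ^ (-s)) ^ (pk.2 + 1) := fun s => by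
    rw [LSeries, ← hinj.tsum_eq fun n hn => by_contra fun h => hn (hsupp s n h)]
    exact tsum_congr fun pk => hterm s pk
  have habs : ∀ f : ℕ → ℂ, (∀ s : ℂ, 1 < s.re → LSeriesSummable f s) →
      LSeries.abscissaOfAbsConv f ≤ (1 : ℝ) := fun f hf =>
    LSeries.abscissaOfAbsConv_le_of_forall_lt_LSeriesSummable fun y hy => hf y (by simpa using hy)
  have haa := habs a ha
  have hbb := habs B hBsum
  have hlt : ∀ {f : ℕ → ℂ}, LSeries.abscissaOfAbsConv f ≤ (1 : ℝ) → ∀ s : ℂ, 1 < s.re →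
      LSeries.abscissaOfAbsConv f < s.re := fun hf s hs =>
    hf.trans_lt (EReal.coe_lt_coe_iff.2 hs)
  have hderiv : ∀ s : ℂ, 1 < s.re →
      LSeries (LSeries.logMul a) s = LSeries a s * LSeries (LSeries.logMul B) s := by
    intro s hs
    have h1 := LSeries_hasDerivAt (hlt haa s hs)
    have h2 := (LSeries_hasDerivAt (hlt hbb s hs)).cexp
    have hev : LSeries a =ᶠ[nhds s] fun z => cexp (LSeries B z) := by
      filter_upwards [(isOpen_lt continuous_const continuous_re).mem_nhds hs] with z hz
      rw [hBtsum, hexp z hz]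
    have h3 := h1.unique (h2.congr_of_eventuallyEq hev)
    have h4 : LSeries a s = cexp (LSeries B s) := hev.self_of_nhds
    rw [h4]
    linear_combination -h3
  have hlogB : LSeries.abscissaOfAbsConv (LSeries.logMul B) ≤ (1 : ℝ) := by
    rwa [LSeries.abscissaOfAbsConv_logMul]
  have key := LSeries.eq_of_LSeries_eventually_eq (f := LSeries.logMul a)
    (g := LSeries.convolution a (LSeries.logMul B))
    (by rw [LSeries.abscissaOfAbsConv_logMul]; exact haa.trans_lt (EReal.coe_lt_top _))
    ((LSeries.abscissaOfAbsConv_convolution_le _ _).trans_lt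
      (max_lt (haa.trans_lt (EReal.coe_lt_top _)) (hlogB.trans_lt (EReal.coe_lt_top _))))
    (by
      filter_upwards [eventually_gt_atTop 1] with x hx
      have hx' : 1 < (x : ℂ).re := by simpa using hx
      rw [hderiv x hx', LSeries_convolution (hlt haa _ hx') (hlt hlogB _ hx')])
    p.2.ne_zero
  have hBp : B p = b p 1 := by
    have : i (p, 0) = p := by simp [hi]
    rw [hB]
    nth_rw 1 [← this]
    rw [hinj.extend_apply]
  rw [LSeries.convolution_def] at key
  simp only [LSeries.logMul] at key
  rw [Nat.sum_divisorsAntidiagonal fun x y => a x * (Complex.log y * B y), p.2.sum_divisors] at key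
  simp only [Nat.div_self p.2.pos, Nat.div_one, Nat.cast_one, Complex.log_one, zero_mul, mul_zero,
    zero_add, hBp] at key
  have hlog : Complex.log ((p : ℕ) : ℂ) ≠ 0 := by
    rw [← natCast_log]
    exact_mod_cast (Real.log_pos (by exact_mod_cast p.2.one_lt)).ne'
  refine mul_left_cancel₀ hlog ?_
  linear_combination key

/-- The sum `∑ b(p^k) ((χ(p) p^{-s})^k - (χ(p) p^{-s})^{2k})` over prime powers: the twist by `χ` of
`log L(s) - log L(2s)`. -/
noncomputable def twistedLogQuotient (b : ℕ → ℕ → ℂ) (χ : Nat.Primes → ℂ) (s : ℂ) : ℂ :=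
  ∑' pk : Nat.Primes × ℕ, b pk.1 (pk.2 + 1) *
    ((χ pk.1 * ((pk.1 : ℕ) : ℂ) ^ (-s)) ^ (pk.2 + 1)
      - ((χ pk.1 * ((pk.1 : ℕ) : ℂ) ^ (-s)) ^ (pk.2 + 1)) ^ 2)

theorem norm_prime_cpow_neg (p : Nat.Primes) (s : ℂ) :
    ‖((p : ℕ) : ℂ) ^ (-s)‖ = ((p : ℕ) : ℝ) ^ (-s.re) := by
  rw [norm_natCast_cpow_of_pos p.2.pos, neg_re]

theorem norm_prime_cpow_neg_le (p : Nat.Primes) {s : ℂ} {σ : ℝ} (hs : σ ≤ s.re) :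
    ‖((p : ℕ) : ℂ) ^ (-s)‖ ≤ ((p : ℕ) : ℝ) ^ (-σ) := by
  rw [norm_prime_cpow_neg]
  exact Real.rpow_le_rpow_of_exponent_le (by exact_mod_cast p.2.one_le) (by linarith)

theorem prime_rpow_neg_le_one (p : Nat.Primes) {σ : ℝ} (hσ : 0 ≤ σ) :
    ((p : ℕ) : ℝ) ^ (-σ) ≤ 1 :=
  Real.rpow_le_one_of_one_le_of_nonpos (by exact_mod_cast p.2.one_le) (by linarith)

theorem norm_pow_sub_pow_sq_le {z : ℂ} {r : ℝ} (hz : ‖z‖ ≤ r) (hr : r ≤ 1) (n : ℕ) :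
    ‖z ^ n - (z ^ n) ^ 2‖ ≤ 2 * r ^ n := by
  have hr0 : 0 ≤ r := (norm_nonneg z).trans hz
  have h1 : ‖z ^ n‖ ≤ r ^ n := by rw [norm_pow]; gcongr
  have h2 : r ^ n ≤ 1 := pow_le_one₀ hr0 hr
  calc ‖z ^ n - (z ^ n) ^ 2‖ ≤ ‖z ^ n‖ + ‖z ^ n‖ ^ 2 := by
        rw [← norm_pow (z ^ n) 2]; exact norm_sub_le _ _
    _ ≤ r ^ n + r ^ n * 1 := by
        rw [sq]; gcongr; exact h1.trans h2
    _ = _ := by ring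

theorem norm_twistedLogQuotient_term_le {b : ℕ → ℕ → ℂ}
    {χ : Nat.Primes → ℂ} (hχ : ∀ p, ‖χ p‖ = 1) {s : ℂ} {σ : ℝ}
    (hσ : 0 ≤ σ) (hs : σ ≤ s.re) (pk : Nat.Primes × ℕ) :
    ‖b pk.1 (pk.2 + 1) * ((χ pk.1 * ((pk.1 : ℕ) : ℂ) ^ (-s)) ^ (pk.2 + 1)
      - ((χ pk.1 * ((pk.1 : ℕ) : ℂ) ^ (-s)) ^ (pk.2 + 1)) ^ 2)‖
      ≤ 2 * (‖b pk.1 (pk.2 + 1)‖ * (((pk.1 : ℕ) : ℝ) ^ (-σ)) ^ (pk.2 + 1)) := by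
  have hz : ‖χ pk.1 * ((pk.1 : ℕ) : ℂ) ^ (-s)‖ ≤ ((pk.1 : ℕ) : ℝ) ^ (-σ) := by
    rw [norm_mul, hχ, one_mul]
    exact norm_prime_cpow_neg_le _ hs
  rw [norm_mul]
  calc _ ≤ ‖b pk.1 (pk.2 + 1)‖ * (2 * (((pk.1 : ℕ) : ℝ) ^ (-σ)) ^ (pk.2 + 1)) := by
        gcongr
        exact norm_pow_sub_pow_sq_le hz (prime_rpow_neg_le_one _ hσ) _
    _ = _ := by ring

theorem summable_twistedLogQuotient {b : ℕ → ℕ → ℂ}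
    (hb : ∀ σ : ℝ, 1 < σ → Summable (fun pk : Nat.Primes × ℕ =>
      ‖b pk.1 (pk.2 + 1)‖ * (((pk.1 : ℕ) : ℝ) ^ (-σ)) ^ (pk.2 + 1)))
    {χ : Nat.Primes → ℂ} (hχ : ∀ p, ‖χ p‖ = 1) {s : ℂ}
    (hs : 1 < s.re) : Summable (fun pk : Nat.Primes × ℕ => b pk.1 (pk.2 + 1) *
      ((χ pk.1 * ((pk.1 : ℕ) : ℂ) ^ (-s)) ^ (pk.2 + 1)
        - ((χ pk.1 * ((pk.1 : ℕ) : ℂ) ^ (-s)) ^ (pk.2 + 1)) ^ 2)) :=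
  .of_norm_bounded ((hb _ hs).mul_left 2)
    (norm_twistedLogQuotient_term_le hχ (by linarith) le_rfl)

theorem differentiableOn_twistedLogQuotient {b : ℕ → ℕ → ℂ}
    (hb : ∀ σ : ℝ, 1 < σ → Summable (fun pk : Nat.Primes × ℕ =>
      ‖b pk.1 (pk.2 + 1)‖ * (((pk.1 : ℕ) : ℝ) ^ (-σ)) ^ (pk.2 + 1)))
    {χ : Nat.Primes → ℂ} (hχ : ∀ p, ‖χ p‖ = 1) {σ : ℝ}
    (hσ : 1 < σ) : DifferentiableOn ℂ (twistedLogQuotient b χ) {s | σ < s.re} := by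
  refine differentiableOn_tsum_of_summable_norm ((hb σ hσ).mul_left 2) (fun pk => ?_)
    (isOpen_lt continuous_const continuous_re) fun pk s hs =>
      norm_twistedLogQuotient_term_le hχ (by linarith) (le_of_lt hs) pk
  have hp : ((pk.1 : ℕ) : ℂ) ≠ 0 := by exact_mod_cast pk.1.2.ne_zero
  have : Differentiable ℂ fun s : ℂ => ((pk.1 : ℕ) : ℂ) ^ (-s) := fun s =>
    (differentiableAt_id.neg).const_cpow (Or.inl hp)
  have h2 := ((this.const_mul (χ pk.1)).pow (pk.2 + 1))
  exact ((h2.sub (h2.pow 2)).const_mul _).differentiableOn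

theorem tendsto_twistedLogQuotient_atTop {b : ℕ → ℕ → ℂ}
    (hb : ∀ σ : ℝ, 1 < σ → Summable (fun pk : Nat.Primes × ℕ =>
      ‖b pk.1 (pk.2 + 1)‖ * (((pk.1 : ℕ) : ℝ) ^ (-σ)) ^ (pk.2 + 1)))
    {χ : Nat.Primes → ℂ} (hχ : ∀ p, ‖χ p‖ = 1) :
    Tendsto (fun x : ℝ => twistedLogQuotient b χ x) atTop (nhds 0) := by
  rw [← tsum_zero (β := Nat.Primes × ℕ)]
  refine tendsto_tsum_of_dominated_convergence ((hb 2 one_lt_two).mul_left 2) (fun pk => ?_) ?_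
  · have h0 : Tendsto (fun x : ℝ => ((pk.1 : ℕ) : ℂ) ^ (-(x : ℂ))) atTop (nhds 0) := by
      rw [tendsto_zero_iff_norm_tendsto_zero]
      simp only [norm_prime_cpow_neg, ofReal_re]
      exact (tendsto_rpow_atBot_of_base_gt_one _ (by exact_mod_cast pk.1.2.one_lt)).comp
        tendsto_neg_atTop_atBot
    have h1 := (h0.const_mul (χ pk.1)).pow (pk.2 + 1)
    simpa using (h1.sub (h1.pow 2)).const_mul (b pk.1 (pk.2 + 1))
  · filter_upwards [eventually_ge_atTop 2] with x hx pk
    exact norm_twistedLogQuotient_term_le hχ zero_le_two (by simpa using hx) pk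

theorem norm_twistedLogQuotient_sub_le {b : ℕ → ℕ → ℂ}
    (hb : ∀ σ : ℝ, 1 < σ → Summable (fun pk : Nat.Primes × ℕ =>
      ‖b pk.1 (pk.2 + 1)‖ * (((pk.1 : ℕ) : ℝ) ^ (-σ)) ^ (pk.2 + 1)))
    {χ ω : Nat.Primes → ℂ} (hχ : ∀ p, ‖χ p‖ = 1)
    (hω : ∀ p, ‖ω p‖ = 1) {s : ℂ} {σ : ℝ} (hσ : 1 < σ) (hs : σ ≤ s.re) :
    ‖twistedLogQuotient b ω s - twistedLogQuotient b χ s‖ ≤ ∑' pk : Nat.Primes × ℕ,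
      ‖b pk.1 (pk.2 + 1)‖ * (((pk.1 : ℕ) : ℝ) ^ (-σ)) ^ (pk.2 + 1) *
        (‖ω pk.1 ^ (pk.2 + 1) - χ pk.1 ^ (pk.2 + 1)‖
          + ‖(ω pk.1 ^ (pk.2 + 1)) ^ 2 - (χ pk.1 ^ (pk.2 + 1)) ^ 2‖) := by
  have hpow : ∀ {f : Nat.Primes → ℂ}, (∀ p, ‖f p‖ = 1) → ∀ p n, ‖f p ^ n‖ = 1 := fun hf p n => by
    rw [norm_pow, hf, one_pow]
  rw [twistedLogQuotient, twistedLogQuotient,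
    ← (summable_twistedLogQuotient hb hω (hσ.trans_le hs)).tsum_sub
      (summable_twistedLogQuotient hb hχ (hσ.trans_le hs))]
  refine tsum_of_norm_bounded (Summable.hasSum ?_) fun pk => ?_
  · refine .of_nonneg_of_le (fun pk => by positivity) (fun pk => ?_) ((hb σ hσ).mul_right 4)
    gcongr
    have h1 := norm_sub_le (ω pk.1 ^ (pk.2 + 1)) (χ pk.1 ^ (pk.2 + 1))
    have h2 := norm_sub_le ((ω pk.1 ^ (pk.2 + 1)) ^ 2) ((χ pk.1 ^ (pk.2 + 1)) ^ 2)
    rw [norm_pow (ω pk.1 ^ _), norm_pow (χ pk.1 ^ _)] at h2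
    rw [hpow hω, hpow hχ] at h1 h2
    linarith
  · set n := pk.2 + 1
    set q := ((pk.1 : ℕ) : ℂ) ^ (-s) with hq
    set r := ((pk.1 : ℕ) : ℝ) ^ (-σ) with hr
    have hqr : ‖q‖ ≤ r := norm_prime_cpow_neg_le _ hs
    have hr1 : r ≤ 1 := prime_rpow_neg_le_one _ (by linarith)
    have hr0 : 0 ≤ r := (norm_nonneg q).trans hqr
    have h1 : ‖q ^ n‖ ≤ r ^ n := by rw [norm_pow]; gcongr
    have h2 : ‖(q ^ n) ^ 2‖ ≤ r ^ n := by
      rw [norm_pow]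
      nlinarith [norm_nonneg (q ^ n), pow_le_one₀ (n := n) hr0 hr1]
    have heq : b pk.1 n * ((ω pk.1 * q) ^ n - ((ω pk.1 * q) ^ n) ^ 2)
        - b pk.1 n * ((χ pk.1 * q) ^ n - ((χ pk.1 * q) ^ n) ^ 2)
        = b pk.1 n * ((ω pk.1 ^ n - χ pk.1 ^ n) * q ^ n
          - ((ω pk.1 ^ n) ^ 2 - (χ pk.1 ^ n) ^ 2) * (q ^ n) ^ 2) := by
      rw [mul_pow, mul_pow]
      ring
    rw [heq, norm_mul, mul_assoc]
    gcongr
    refine (norm_sub_le _ _).trans ?_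
    rw [norm_mul, norm_mul, mul_add, mul_comm (r ^ n), mul_comm (r ^ n)]
    gcongr

/-- A value taken by a vertical twist is taken by the untwisted function at arbitrarily large
heights. -/
theorem exists_twistedLogQuotient_eq_of_twist {b : ℕ → ℕ → ℂ}
    (hb : ∀ σ : ℝ, 1 < σ → Summable (fun pk : Nat.Primes × ℕ =>
      ‖b pk.1 (pk.2 + 1)‖ * (((pk.1 : ℕ) : ℝ) ^ (-σ)) ^ (pk.2 + 1)))
    {χ : Nat.Primes → ℂ} (hχ : ∀ p, ‖χ p‖ = 1) {σ : ℝ}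
    (hσ : 1 < σ) {v : ℂ} (hv0 : v ≠ 0) (hv : twistedLogQuotient b χ σ = v) (T : ℝ) :
    ∃ s : ℂ, 1 < s.re ∧ T ≤ s.im ∧ twistedLogQuotient b 1 s = v := by
  obtain ⟨σ₀, hσ₀, hσ₀σ⟩ := exists_between hσ
  set U : Set ℂ := {s | σ₀ < s.re} with hU
  have hUo : IsOpen U := isOpen_lt continuous_const continuous_re
  have hUc : IsPreconnected U := (convex_halfSpace_re_gt σ₀).isPreconnected
  have hσU : (σ : ℂ) ∈ U := hσ₀σ
  have hAn : ∀ {ω : Nat.Primes → ℂ}, (∀ p, ‖ω p‖ = 1) →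
      AnalyticOnNhd ℂ (twistedLogQuotient b ω) U := fun hω =>
    (differentiableOn_twistedLogQuotient hb hω hσ₀).analyticOnNhd hUo
  have hne : ∀ᶠ z in nhdsWithin (σ : ℂ) {(σ : ℂ)}ᶜ, twistedLogQuotient b χ z ≠ v := by
    by_contra hcon
    have hEq := (hAn hχ).eqOn_of_preconnected_of_frequently_eq analyticOnNhd_const hUc hσU
      (g := fun _ => v) (by simpa [not_eventually] using hcon)
    refine hv0 (tendsto_nhds_unique (tendsto_const_nhds.congr' ?_)
      (tendsto_twistedLogQuotient_atTop hb hχ))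
    filter_upwards [eventually_gt_atTop σ₀] with x hx
    exact (hEq (by simpa [hU] using hx)).symm
  rw [eventually_nhdsWithin_iff] at hne
  obtain ⟨ρ, hρ, hball⟩ := Metric.eventually_nhds_iff_ball.1 (hne.and (hUo.mem_nhds hσU))
  obtain ⟨r, hr, hrρ⟩ := exists_between hρ
  have hclosed : Metric.closedBall (σ : ℂ) r ⊆ Metric.ball (σ : ℂ) ρ :=
    Metric.closedBall_subset_ball hrρ
  have hballU : Metric.closedBall (σ : ℂ) r ⊆ U := fun z hz => (hball z (hclosed hz)).2
  have hsph : ∀ z ∈ Metric.sphere (σ : ℂ) r, twistedLogQuotient b χ z ≠ v := fun z hz =>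
    (hball z (hclosed (Metric.sphere_subset_closedBall hz))).1 (Metric.ne_of_mem_sphere hz hr.ne')
  obtain ⟨z₁, hz₁, hmin⟩ := (isCompact_sphere (σ : ℂ) r).exists_isMinOn
    (NormedSpace.sphere_nonempty.2 hr.le)
    (f := fun z => ‖twistedLogQuotient b χ z - v‖)
    (((hAn hχ).continuousOn.mono (Metric.sphere_subset_closedBall.trans hballU)).sub
      continuousOn_const).norm
  set m := ‖twistedLogQuotient b χ z₁ - v‖ with hm
  have hmpos : 0 < m := norm_pos_iff.2 (sub_ne_zero.2 (hsph z₁ hz₁))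
  obtain ⟨F, hF, hFχ⟩ := mapClusterPt_iff_ultrafilter.1 (mapClusterPt_prime_twist χ hχ)
  set ω : ℝ → Nat.Primes → ℂ := fun t p => ((p : ℕ) : ℂ) ^ (-((t : ℂ) * I)) with hω
  have hω1 : ∀ t p, ‖ω t p‖ = 1 := fun t p => by
    simp [hω, norm_prime_cpow_neg]
  have hΔ : Tendsto (fun t => ∑' pk : Nat.Primes × ℕ,
      ‖b pk.1 (pk.2 + 1)‖ * (((pk.1 : ℕ) : ℝ) ^ (-σ₀)) ^ (pk.2 + 1) *
        (‖ω t pk.1 ^ (pk.2 + 1) - χ pk.1 ^ (pk.2 + 1)‖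
          + ‖(ω t pk.1 ^ (pk.2 + 1)) ^ 2 - (χ pk.1 ^ (pk.2 + 1)) ^ 2‖)) F (nhds 0) := by
    rw [← tsum_zero (β := Nat.Primes × ℕ)]
    refine tendsto_tsum_of_dominated_convergence ((hb σ₀ hσ₀).mul_right 4) (fun pk => ?_)
      (Eventually.of_forall fun t pk => ?_)
    · have h1 : Tendsto (fun t => ω t pk.1 ^ (pk.2 + 1)) F (nhds (χ pk.1 ^ (pk.2 + 1))) :=
        ((tendsto_pi_nhds.1 hFχ) pk.1).pow _
      have h2 := (h1.sub_const (χ pk.1 ^ (pk.2 + 1))).norm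
      have h3 := ((h1.pow 2).sub_const ((χ pk.1 ^ (pk.2 + 1)) ^ 2)).norm
      simpa using (h2.add h3).const_mul
        (‖b pk.1 (pk.2 + 1)‖ * (((pk.1 : ℕ) : ℝ) ^ (-σ₀)) ^ (pk.2 + 1))
    · rw [Real.norm_of_nonneg (by positivity)]
      gcongr
      have h1 := norm_sub_le (ω t pk.1 ^ (pk.2 + 1)) (χ pk.1 ^ (pk.2 + 1))
      have h2 := norm_sub_le ((ω t pk.1 ^ (pk.2 + 1)) ^ 2) ((χ pk.1 ^ (pk.2 + 1)) ^ 2)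
      simp only [norm_pow, hω1, hχ, one_pow] at h1 h2
      linarith
  obtain ⟨t, htΔ, htT⟩ := ((hΔ.eventually (gt_mem_nhds (show 0 < m / 4 by positivity))).and
    (hF (eventually_ge_atTop (T + r)))).exists
  have hclose : ∀ z ∈ U,
      ‖twistedLogQuotient b (ω t) z - twistedLogQuotient b χ z‖ < m / 4 := fun z hz =>
    (norm_twistedLogQuotient_sub_le hb hχ (hω1 t) hσ₀ (le_of_lt hz)).trans_lt htΔ
  have hcenter : ‖twistedLogQuotient b (ω t) σ - v‖ < m / 4 := by
    rw [← hv]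
    exact hclose σ hσU
  have hsphere : ∀ z ∈ Metric.sphere (σ : ℂ) r,
      m / 2 ≤ ‖twistedLogQuotient b (ω t) z - twistedLogQuotient b (ω t) σ‖ := by
    intro z hz
    have h1 := hclose z (hballU (Metric.sphere_subset_closedBall hz))
    have h2 : m ≤ ‖twistedLogQuotient b χ z - v‖ := hmin hz
    have h3 : twistedLogQuotient b χ z - v
        = (twistedLogQuotient b (ω t) z - twistedLogQuotient b (ω t) σ)
          - (twistedLogQuotient b (ω t) z - twistedLogQuotient b χ z)
          + (twistedLogQuotient b (ω t) σ - v) := by ring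
    rw [h3] at h2
    have h4 := norm_add_le ((twistedLogQuotient b (ω t) z - twistedLogQuotient b (ω t) σ)
          - (twistedLogQuotient b (ω t) z - twistedLogQuotient b χ z))
          (twistedLogQuotient b (ω t) σ - v)
    have h5 := norm_sub_le (twistedLogQuotient b (ω t) z - twistedLogQuotient b (ω t) σ)
      (twistedLogQuotient b (ω t) z - twistedLogQuotient b χ z)
    linarith
  have hfreq : ∃ᶠ z in nhds (σ : ℂ), twistedLogQuotient b (ω t) z ≠ twistedLogQuotient b (ω t) σ := by
    intro hcon
    have hEq := (hAn (hω1 t)).eqOn_of_preconnected_of_eventuallyEq analyticOnNhd_const hUc hσU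
      (g := fun _ => twistedLogQuotient b (ω t) σ) (by simpa using! hcon)
    have := hsphere z₁ hz₁
    rw [hEq (hballU (Metric.sphere_subset_closedBall hz₁)), sub_self, norm_zero] at this
    linarith
  have hdiff : DiffContOnCl ℂ (twistedLogQuotient b (ω t)) (Metric.ball (σ : ℂ) r) := by
    refine DifferentiableOn.diffContOnCl ?_
    rw [closure_ball _ hr.ne']
    exact (differentiableOn_twistedLogQuotient hb (hω1 t) hσ₀).mono hballU
  obtain ⟨z, hz, hzv⟩ := hdiff.ball_subset_image_closedBall hr hsphere hfreq
    (show v ∈ _ by rw [mem_ball_iff_norm, norm_sub_rev]; linarith)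
  have hzre : σ₀ < z.re := hballU hz
  refine ⟨z + t * I, by simpa using hσ₀.trans hzre, ?_, ?_⟩
  · have := (abs_im_le_norm (z - σ)).trans (mem_closedBall_iff_norm.1 hz)
    simp only [sub_im, ofReal_im, sub_zero] at this
    have h2 := neg_abs_le z.im
    simp
    linarith
  · rw [← hzv]
    refine tsum_congr fun pk => ?_
    have hp : ((pk.1 : ℕ) : ℂ) ≠ 0 := by exact_mod_cast pk.1.2.ne_zero
    rw [neg_add, cpow_add _ _ hp, Pi.one_apply, one_mul, mul_comm (_ ^ (-z))]

theorem norm_exp_ofReal_mul_I_sub_le (s t : ℝ) : ‖cexp (s * I) - cexp (t * I)‖ ≤ |s - t| := by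
  have h : cexp (s * I) - cexp (t * I) = cexp (t * I) * (cexp (I * ((s - t : ℝ) : ℂ)) - 1) := by
    rw [mul_sub, ← Complex.exp_add, mul_one]
    push_cast
    ring_nf
  rw [h, norm_mul, norm_exp_ofReal_mul_I, one_mul]
  exact Real.norm_exp_I_mul_ofReal_sub_one_le

theorem norm_exp_ofReal_mul_I_sub_sub_le {δ s t : ℝ} (hs : |s| ≤ δ) (ht : |t| ≤ δ) :
    ‖cexp (s * I) - cexp (t * I) - (s - t) * I‖ ≤ δ * |s - t| := by
  have hd : ∀ u : ℝ, HasDerivAt (fun u : ℝ => cexp (u * I) - u * I) (cexp (u * I) * I - I) u := by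
    intro u
    have h1 : HasDerivAt (fun u : ℝ => (u : ℂ) * I) I u := by
      simpa using (ofRealCLM.hasDerivAt (x := u)).mul_const I
    exact h1.cexp.sub h1
  have := (convex_Icc (-δ) δ).norm_image_sub_le_of_norm_hasDerivWithin_le (C := δ)
    (fun u _ => (hd u).hasDerivWithinAt) (fun u hu => ?_) (abs_le.1 ht) (abs_le.1 hs)
  · rw [Real.norm_eq_abs] at this
    refine le_trans (le_of_eq ?_) this
    congr 1
    ring
  · have h := norm_exp_ofReal_mul_I_sub_le u 0
    rw [← sub_one_mul, norm_mul, norm_I, mul_one]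
    simp only [ofReal_zero, zero_mul, Complex.exp_zero, sub_zero] at h
    exact h.trans (abs_le.2 hu)

/-- Two arcs of circles through orthogonal directions, slightly perturbed, cover a ball. -/
theorem exists_arcs_add_eq {α β : ℝ} (hα : 1 ≤ α) (hβ : 1 ≤ β) {R : ℂ → ℂ}
    (hR : ∀ z z', ‖R z - R z'‖ ≤ 1 / 4 * ‖z - z'‖) {W : ℂ}
    (hW : ‖W - (-I * α + β + R 0)‖ ≤ 1 / 16) :
    ∃ z : ℂ, -I * α * cexp ((z.re / α : ℝ) * I) + β * cexp ((z.im / β : ℝ) * I) + R z = W := by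
  set f : ℂ → ℂ := fun z =>
    -I * α * cexp ((z.re / α : ℝ) * I) + β * cexp ((z.im / β : ℝ) * I) + R z with hf
  have harc : ∀ {γ : ℝ}, 1 ≤ γ → ∀ {u t : ℝ}, |u| ≤ 1 / 8 → |t| ≤ 1 / 8 →
      ‖γ * (cexp ((u / γ : ℝ) * I) - cexp ((t / γ : ℝ) * I)) - (u - t) * I‖
        ≤ 1 / 8 * |u - t| := by
    intro γ hγ u t hu ht
    have hγ0 : 0 < γ := by linarith
    have hdiv : ∀ {u : ℝ}, |u| ≤ 1 / 8 → |u / γ| ≤ 1 / 8 := fun {u} hu => by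
      rw [abs_div, abs_of_pos hγ0]
      exact (div_le_self (abs_nonneg _) hγ).trans hu
    have h := norm_exp_ofReal_mul_I_sub_sub_le (hdiv hu) (hdiv ht)
    have heq : γ * (cexp ((u / γ : ℝ) * I) - cexp ((t / γ : ℝ) * I)) - (u - t) * I
        = γ * (cexp ((u / γ : ℝ) * I) - cexp ((t / γ : ℝ) * I)
          - ((u / γ : ℝ) - (t / γ : ℝ)) * I) := by
      have : (γ : ℂ) ≠ 0 := by exact_mod_cast hγ0.ne'
      push_cast
      field_simp
    rw [heq, norm_mul, norm_real, Real.norm_of_nonneg hγ0.le]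
    calc _ ≤ γ * (1 / 8 * |u / γ - t / γ|) := by gcongr
      _ = 1 / 8 * |u - t| := by
        rw [← sub_div, abs_div, abs_of_pos hγ0]
        field_simp
  have happ : ApproximatesLinearOn f (ContinuousLinearEquiv.refl ℂ ℂ : ℂ →L[ℂ] ℂ)
      (Metric.closedBall 0 (1 / 8)) (1 / 2) := by
    intro z hz z' hz'
    rw [mem_closedBall_zero_iff] at hz hz'
    have h1 := harc hα ((abs_re_le_norm z).trans hz) ((abs_re_le_norm z').trans hz')
    have h2 := harc hβ ((abs_im_le_norm z).trans hz) ((abs_im_le_norm z').trans hz')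
    have h3 : |z.re - z'.re| ≤ ‖z - z'‖ := abs_re_le_norm (z - z')
    have h4 : |z.im - z'.im| ≤ ‖z - z'‖ := abs_im_le_norm (z - z')
    have heq : f z - f z' - (z - z')
        = -I * (α * (cexp ((z.re / α : ℝ) * I) - cexp ((z'.re / α : ℝ) * I))
            - (z.re - z'.re) * I)
          + (β * (cexp ((z.im / β : ℝ) * I) - cexp ((z'.im / β : ℝ) * I))
            - (z.im - z'.im) * I) + (R z - R z') := by
      linear_combination (z'.re - z.re : ℂ) * I_sq + re_add_im z - re_add_im z'
    simp only [ContinuousLinearEquiv.coe_coe, ContinuousLinearEquiv.coe_refl', id]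
    rw [heq]
    refine norm_add₃_le.trans ?_
    rw [norm_mul, norm_neg, norm_I, one_mul]
    have := hR z z'
    rw [show (((1 / 2 : NNReal)) : ℝ) = 1 / 2 by norm_num]
    linarith
  have hsurj := happ.surjOn_closedBall_of_nonlinearRightInverse
    (ContinuousLinearEquiv.refl ℂ ℂ).toNonlinearRightInverse (b := 0) (ε := 1 / 8)
    (by norm_num) le_rfl
  obtain ⟨z, -, hz⟩ := hsurj (show W ∈ _ by
    rw [mem_closedBall_iff_norm]
    have hn : ((ContinuousLinearEquiv.refl ℂ ℂ).toNonlinearRightInverse.nnnorm : ℝ) = 1 := by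
      simp [ContinuousLinearEquiv.toNonlinearRightInverse]
    rw [hn]
    refine le_trans (le_of_eq ?_) (hW.trans (le_of_eq ?_))
    · simp [hf]
    · norm_num)
  exact ⟨z, hz⟩

/-- If the steps `x p` are small and add up to at least the distance of `w` from the origin, a walk
with these step lengths can be steered from `0` to near `w`. -/
theorem exists_unit_norm_sub_sum_le {ι : Type*} {x : ι → ℝ} {η : ℝ} (D : Finset ι)
    (hx : ∀ p ∈ D, 0 ≤ x p ∧ x p ≤ η) {w : ℂ} (hw : ‖w‖ ≤ ∑ p ∈ D, x p + η) :
    ∃ ω : ι → ℂ, (∀ p, ‖ω p‖ = 1) ∧ ‖w - ∑ p ∈ D, x p * ω p‖ ≤ η := by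
  classical
  induction D using Finset.induction_on generalizing w with
  | empty => exact ⟨1, by simp, by simpa using hw⟩
  | insert p D hp ih =>
    obtain ⟨hx0, hxη⟩ := hx p (Finset.mem_insert_self p D)
    rw [Finset.sum_insert hp] at hw
    obtain ⟨e, he, hwe⟩ : ∃ e : ℂ, ‖e‖ = 1 ∧ w = ‖w‖ * e := by
      refine ⟨cexp (arg w * I), norm_exp_ofReal_mul_I _, (norm_mul_exp_arg_mul_I w).symm⟩
    have hrem : ‖w - x p * e‖ = |‖w‖ - x p| := by
      conv_lhs => rw [hwe, ← sub_mul, norm_mul, he, mul_one, ← ofReal_sub, norm_real]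
      rfl
    have hsum : 0 ≤ ∑ q ∈ D, x q :=
      Finset.sum_nonneg fun q hq => (hx q (Finset.mem_insert_of_mem hq)).1
    obtain ⟨ω, hω, hωw⟩ := ih (fun q hq => hx q (Finset.mem_insert_of_mem hq))
      (w := w - x p * e) (by
        rw [hrem, abs_le]
        constructor <;> linarith [norm_nonneg w])
    refine ⟨Function.update ω p e, fun q => ?_, ?_⟩
    · rcases eq_or_ne q p with rfl | hq
      · simpa using he
      · simpa [hq] using hω q
    · rw [Finset.sum_insert hp, Function.update_self,
        Finset.sum_congr rfl fun q hq => by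
          rw [Function.update_of_ne (ne_of_mem_of_not_mem hq hp)], ← sub_sub]
      exact hωw

/-- If `∑ x p` can be split into a small tail and groups large enough to steer the sum, every value
within reach is attained by `∑ (x p * ω p + r p (ω p))` for suitable unit complex numbers `ω p`. -/
theorem exists_unit_tsum_eq {ι : Type*} [DecidableEq ι] {x E : ι → ℝ} {r : ι → ℂ → ℂ}
    (hx : ∀ p, 0 ≤ x p) (hxs : Summable x) (hEs : Summable E)
    (hr : ∀ p ω, ‖ω‖ = 1 → ‖r p ω‖ ≤ E p)
    (hr' : ∀ p ω ω', ‖ω‖ = 1 → ‖ω'‖ = 1 → ‖r p ω - r p ω'‖ ≤ E p * ‖ω - ω'‖)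
    {P A B D : Finset ι} (hA : Disjoint A P) (hB : Disjoint B (P ∪ A))
    (hD : Disjoint D (P ∪ A ∪ B)) (hxP : ∀ p, p ∉ P → x p ≤ 1 / 128)
    (hEP : ∀ F : Finset ι, Disjoint F P → ∑ p ∈ F, E p ≤ 1 / 128)
    (hxD : ∀ F : Finset ι, Disjoint F (P ∪ A ∪ B ∪ D) → ∑ p ∈ F, x p ≤ 1 / 128)
    (hα : 1 ≤ ∑ p ∈ A, x p) (hβ : 1 ≤ ∑ p ∈ B, x p) {v : ℂ}
    (hv : ‖v‖ + ∑ p ∈ A, x p + ∑ p ∈ B, x p + ∑ p ∈ P, (x p + E p) ≤ ∑ p ∈ D, x p) :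
    ∃ ω : ι → ℂ, (∀ p, ‖ω p‖ = 1) ∧ ∑' p, (x p * ω p + r p (ω p)) = v := by
  set α := ∑ p ∈ A, x p with hαdef
  set β := ∑ p ∈ B, x p with hβdef
  have hE : ∀ p, 0 ≤ E p := fun p => (norm_nonneg _).trans (hr p 1 norm_one)
  have hnorm : ∀ p ω, ‖ω‖ = 1 → ‖x p * ω + r p ω‖ ≤ x p + E p := fun p ω hω => by
    refine (norm_add_le _ _).trans ?_
    rw [norm_mul, hω, mul_one, norm_real, Real.norm_of_nonneg (hx p)]
    linarith [hr p ω hω]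
  set w : ℂ := v - ∑ p ∈ P, (x p * 1 + r p 1) - (-I * α + β) with hw
  have hwn : ‖w‖ ≤ ∑ p ∈ D, x p + 1 / 128 := by
    have h1 : ‖∑ p ∈ P, ((x p : ℂ) * 1 + r p 1)‖ ≤ ∑ p ∈ P, (x p + E p) :=
      norm_sum_le_of_le _ fun p _ => hnorm p 1 norm_one
    have h2 : ‖-I * (α : ℂ) + β‖ ≤ α + β := by
      refine (norm_add_le _ _).trans ?_
      rw [norm_mul, norm_neg, norm_I, one_mul, norm_real, norm_real,
        Real.norm_of_nonneg (by linarith), Real.norm_of_nonneg (by linarith)]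
    have h3 := norm_sub_le (v - ∑ p ∈ P, ((x p : ℂ) * 1 + r p 1)) (-I * α + β)
    have h4 := norm_sub_le v (∑ p ∈ P, ((x p : ℂ) * 1 + r p 1))
    linarith
  have hDP : ∀ p ∈ D, p ∉ P := fun p hp hP =>
    Finset.disjoint_left.1 hD hp (by simp [hP])
  obtain ⟨ωD, hωD, hwD⟩ := exists_unit_norm_sub_sum_le D (fun p hp => ⟨hx p, hxP p (hDP p hp)⟩) hwn
  set e : ℝ → ℂ := fun t => cexp (t * I) with he
  have he1 : ∀ t, ‖e t‖ = 1 := norm_exp_ofReal_mul_I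
  have hIe : ∀ t, ‖-I * e t‖ = 1 := fun t => by simp [he1]
  set R : ℂ → ℂ := fun z =>
    ∑ p ∈ A, r p (-I * e (z.re / α)) + ∑ p ∈ B, r p (e (z.im / β)) with hR
  have hAP : ∑ p ∈ A, E p ≤ 1 / 128 := hEP A hA
  have hBP : ∑ p ∈ B, E p ≤ 1 / 128 := hEP B (hB.mono_right Finset.subset_union_left)
  have hDE : ∑ p ∈ D, E p ≤ 1 / 128 := hEP D (Finset.disjoint_left.2 hDP)
  have hRlip : ∀ z z', ‖R z - R z'‖ ≤ 1 / 4 * ‖z - z'‖ := by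
    intro z z'
    have hdiv : ∀ {γ s t : ℝ}, 1 ≤ γ → |s - t| ≤ ‖z - z'‖ →
        ‖e (s / γ) - e (t / γ)‖ ≤ ‖z - z'‖ := fun {γ s t} hγ hst => by
      refine (norm_exp_ofReal_mul_I_sub_le _ _).trans (le_trans ?_ hst)
      rw [← sub_div, abs_div, abs_of_pos (by linarith : (0 : ℝ) < γ)]
      exact div_le_self (abs_nonneg _) hγ
    have h1 : ‖∑ p ∈ A, (r p (-I * e (z.re / α)) - r p (-I * e (z'.re / α)))‖
        ≤ ∑ p ∈ A, E p * ‖z - z'‖ := norm_sum_le_of_le _ fun p _ => by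
      refine (hr' p _ _ (hIe _) (hIe _)).trans (mul_le_mul_of_nonneg_left ?_ (hE p))
      rw [← mul_sub, norm_mul, norm_neg, norm_I, one_mul]
      exact hdiv hα (abs_re_le_norm (z - z'))
    have h2 : ‖∑ p ∈ B, (r p (e (z.im / β)) - r p (e (z'.im / β)))‖
        ≤ ∑ p ∈ B, E p * ‖z - z'‖ := norm_sum_le_of_le _ fun p _ => by
      refine (hr' p _ _ (he1 _) (he1 _)).trans (mul_le_mul_of_nonneg_left ?_ (hE p))
      exact hdiv hβ (abs_im_le_norm (z - z'))
    rw [← Finset.sum_mul] at h1 h2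
    have h3 : R z - R z' = ∑ p ∈ A, (r p (-I * e (z.re / α)) - r p (-I * e (z'.re / α)))
        + ∑ p ∈ B, (r p (e (z.im / β)) - r p (e (z'.im / β))) := by
      rw [Finset.sum_sub_distrib, Finset.sum_sub_distrib]
      ring
    rw [h3]
    refine (norm_add_le _ _).trans ?_
    nlinarith [norm_nonneg (z - z')]
  have hR0 : ‖R 0‖ ≤ 2 / 128 := by
    have h1 : ‖∑ p ∈ A, r p (-I * e ((0 : ℂ).re / α))‖ ≤ ∑ p ∈ A, E p :=
      norm_sum_le_of_le _ fun p _ => hr p _ (hIe _)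
    have h2 : ‖∑ p ∈ B, r p (e ((0 : ℂ).im / β))‖ ≤ ∑ p ∈ B, E p :=
      norm_sum_le_of_le _ fun p _ => hr p _ (he1 _)
    refine (norm_add_le _ _).trans ?_
    linarith
  set S := P ∪ A ∪ B ∪ D with hS
  have hsum : ∀ ω : ι → ℂ, (∀ p, ‖ω p‖ = 1) → Summable fun p => x p * ω p + r p (ω p) :=
    fun ω hω => .of_norm_bounded (hxs.add hEs) fun p => hnorm p _ (hω p)
  set τ : ℂ := ∑' p : ((S : Set ι)ᶜ : Set ι), (x p * 1 + r p 1) with hτ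
  have hτn : ‖τ‖ ≤ 2 / 128 := by
    have hs : Summable fun p : ((S : Set ι)ᶜ : Set ι) => x p + E p :=
      (hxs.add hEs).subtype _
    refine (tsum_of_norm_bounded hs.hasSum fun p => hnorm p 1 norm_one).trans ?_
    refine hs.tsum_le_of_sum_le fun F => ?_
    have hFS : Disjoint (F.map (Function.Embedding.subtype _)) S := by
      rw [Finset.disjoint_left]
      intro p hp
      obtain ⟨q, -, rfl⟩ := Finset.mem_map.1 hp
      exact q.2
    have h1 := hxD _ hFS
    have h2 := hEP _ (hFS.mono_right (by
      simp only [hS, Finset.union_assoc]; exact Finset.subset_union_left))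
    rw [Finset.sum_map] at h1 h2
    rw [Finset.sum_add_distrib]
    simp only [Function.Embedding.subtype_apply] at h1 h2
    linarith
  set W : ℂ := v - ∑ p ∈ P, (x p * 1 + r p 1) - ∑ p ∈ D, (x p * ωD p + r p (ωD p)) - τ with hW
  have hDr : ‖∑ p ∈ D, r p (ωD p)‖ ≤ 1 / 128 :=
    (norm_sum_le_of_le _ fun p _ => hr p _ (hωD p)).trans hDE
  obtain ⟨z, hz⟩ := exists_arcs_add_eq hα hβ hRlip (W := W) (by
    have h1 : W - (-I * α + β + R 0)
        = (w - ∑ p ∈ D, x p * ωD p) - ∑ p ∈ D, r p (ωD p) - τ - R 0 := by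
      rw [hW, Finset.sum_add_distrib (s := D), hw]
      ring
    rw [h1]
    have h2 := norm_sub_le ((w - ∑ p ∈ D, x p * ωD p) - ∑ p ∈ D, r p (ωD p) - τ) (R 0)
    have h3 := norm_sub_le ((w - ∑ p ∈ D, x p * ωD p) - ∑ p ∈ D, r p (ωD p)) τ
    have h4 := norm_sub_le (w - ∑ p ∈ D, x p * ωD p) (∑ p ∈ D, r p (ωD p))
    linarith)
  have hAB : ∀ p ∈ B, p ∉ A := fun p hp h => Finset.disjoint_left.1 hB hp (by simp [h])
  have hDA : ∀ p ∈ D, p ∉ A := fun p hp h => Finset.disjoint_left.1 hD hp (by simp [h])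
  have hDB : ∀ p ∈ D, p ∉ B := fun p hp h => Finset.disjoint_left.1 hD hp (by simp [h])
  set ω : ι → ℂ := fun p => if p ∈ A then -I * e (z.re / α) else if p ∈ B then e (z.im / β)
    else if p ∈ D then ωD p else 1 with hω
  have hωn : ∀ p, ‖ω p‖ = 1 := fun p => by
    simp only [hω]
    split_ifs
    exacts [hIe _, he1 _, hωD p, norm_one]
  have hωP : ∀ p ∈ P, ω p = 1 := fun p hp => by
    have h1 : p ∉ A := fun h => Finset.disjoint_left.1 hA h hp
    have h2 : p ∉ B := fun h => Finset.disjoint_left.1 hB h (by simp [hp])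
    have h3 : p ∉ D := fun h => hDP p h hp
    simp [hω, h1, h2, h3]
  refine ⟨ω, hωn, ?_⟩
  rw [← (hsum ω hωn).sum_add_tsum_compl (s := S), hS, Finset.sum_union hD.symm,
    Finset.sum_union hB.symm, Finset.sum_union hA.symm, ← hS]
  have hcompl : ∑' p : ((S : Set ι)ᶜ : Set ι), ((x p : ℂ) * ω p + r p (ω p)) = τ :=
    tsum_congr fun p => by
      have hp : (p : ι) ∉ S := p.2
      simp only [hS, Finset.mem_union, not_or] at hp
      simp [hω, hp]
  have hsP : ∑ p ∈ P, (x p * ω p + r p (ω p)) = ∑ p ∈ P, (x p * 1 + r p 1) :=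
    Finset.sum_congr rfl fun p hp => by rw [hωP p hp]
  have hsA : ∑ p ∈ A, (x p * ω p + r p (ω p))
      = -I * α * e (z.re / α) + ∑ p ∈ A, r p (-I * e (z.re / α)) := by
    rw [Finset.sum_congr rfl fun p hp => by rw [show ω p = -I * e (z.re / α) by simp [hω, hp]],
      Finset.sum_add_distrib, ← Finset.sum_mul, hαdef]
    push_cast
    ring
  have hsB : ∑ p ∈ B, (x p * ω p + r p (ω p))
      = β * e (z.im / β) + ∑ p ∈ B, r p (e (z.im / β)) := by
    rw [Finset.sum_congr rfl fun p hp => by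
        rw [show ω p = e (z.im / β) by simp [hω, hp, hAB p hp]],
      Finset.sum_add_distrib, ← Finset.sum_mul, hβdef]
    push_cast
    ring
  have hsD : ∑ p ∈ D, (x p * ω p + r p (ω p)) = ∑ p ∈ D, (x p * ωD p + r p (ωD p)) :=
    Finset.sum_congr rfl fun p hp => by
      rw [show ω p = ωD p by simp [hω, hp, hDA p hp, hDB p hp]]
  rw [hcompl, hsP, hsA, hsB, hsD]
  simp only [hR] at hz
  linear_combination hz + hW

theorem Summable.exists_finset_sum_le {ι : Type*} {f : ι → ℝ} (hf : Summable f) {ε : ℝ}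
    (hε : 0 < ε) : ∃ T : Finset ι, ∀ F : Finset ι, Disjoint F T → ∑ p ∈ F, f p ≤ ε := by
  obtain ⟨T, hT⟩ := summable_iff_vanishing_norm.1 hf ε hε
  exact ⟨T, fun F hF => (le_abs_self _).trans (hT F hF).le⟩

theorem exists_finset_le_sum_of_tendsto {ι : Type*} [DecidableEq ι] {x : ℝ → ι → ℝ} {c : ι → ℝ}
    (hx : ∀ σ, 1 < σ → ∀ p, 0 ≤ x σ p) (hxc : ∀ σ, 1 < σ → ∀ p, x σ p ≤ c p)
    (hxs : ∀ σ, 1 < σ → Summable (x σ))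
    (hlim : Tendsto (fun σ => ∑' p, x σ p) (nhdsWithin 1 (Set.Ioi 1)) atTop)
    (P : Finset ι) (X : ℝ) {σ₁ : ℝ} (hσ₁ : 1 < σ₁) {ε : ℝ} (hε : 0 < ε) :
    ∃ σ, 1 < σ ∧ σ < σ₁ ∧ ∃ D : Finset ι, Disjoint D P ∧ X ≤ ∑ p ∈ D, x σ p ∧
      ∀ F : Finset ι, Disjoint F (P ∪ D) → ∑ p ∈ F, x σ p ≤ ε := by
  obtain ⟨σ, hX, hσ, hσσ₁⟩ := ((hlim.eventually_ge_atTop (X + ∑ p ∈ P, c p + ε)).and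
    (Ioo_mem_nhdsGT hσ₁)).exists
  obtain ⟨T, hT⟩ := (hxs σ hσ).exists_finset_sum_le hε
  refine ⟨σ, hσ, hσσ₁, T \ P, Finset.sdiff_disjoint, ?_, fun F hF => hT F (hF.mono_right ?_)⟩
  · have h1 : ∑' p, x σ p ≤ ∑ p ∈ T, x σ p + ε := by
      refine (hxs σ hσ).tsum_le_of_sum_le fun F => ?_
      rw [← Finset.sum_inter_add_sum_sdiff F T]
      exact add_le_add (Finset.sum_le_sum_of_subset_of_nonneg Finset.inter_subset_right
        fun p _ _ => hx σ hσ p) (hT _ Finset.sdiff_disjoint)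
    have h2 : ∑ p ∈ T, x σ p ≤ ∑ p ∈ P, c p + ∑ p ∈ T \ P, x σ p := by
      rw [← Finset.sum_inter_add_sum_sdiff T P]
      gcongr
      exact (Finset.sum_le_sum_of_subset_of_nonneg Finset.inter_subset_right
        fun p _ _ => hx σ hσ p).trans (Finset.sum_le_sum fun p _ => hxc σ hσ p)
    linarith
  · intro p hp
    by_cases hP : p ∈ P <;> simp [hp, hP]

theorem exists_unit_tsum_eq_of_tendsto {ι : Type*} {x : ℝ → ι → ℝ} {c E : ι → ℝ}
    {r : ℝ → ι → ℂ → ℂ}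
    (hx : ∀ σ, 1 < σ → ∀ p, 0 ≤ x σ p) (hxc : ∀ σ, 1 < σ → ∀ p, x σ p ≤ c p)
    (hxanti : ∀ σ₁ σ₂, σ₁ ≤ σ₂ → ∀ p, x σ₂ p ≤ x σ₁ p)
    (hxs : ∀ σ, 1 < σ → Summable (x σ))
    (hlim : Tendsto (fun σ => ∑' p, x σ p) (nhdsWithin 1 (Set.Ioi 1)) atTop)
    (hcs : Summable fun p => c p ^ 2) (hEs : Summable E)
    (hr : ∀ σ, 1 < σ → ∀ p ω, ‖ω‖ = 1 → ‖r σ p ω‖ ≤ E p)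
    (hr' : ∀ σ, 1 < σ → ∀ p ω ω', ‖ω‖ = 1 → ‖ω'‖ = 1 →
      ‖r σ p ω - r σ p ω'‖ ≤ E p * ‖ω - ω'‖) (v : ℂ) :
    ∃ σ, 1 < σ ∧ ∃ ω : ι → ℂ, (∀ p, ‖ω p‖ = 1) ∧ ∑' p, (x σ p * ω p + r σ p (ω p)) = v := by
  classical
  obtain ⟨P₁, hP₁⟩ := hEs.exists_finset_sum_le (show (0 : ℝ) < 1 / 128 by norm_num)
  obtain ⟨P₂, hP₂⟩ := hcs.exists_finset_sum_le (show (0 : ℝ) < (1 / 128) ^ 2 by norm_num)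
  set P := P₁ ∪ P₂ with hP
  have hcP : ∀ p, p ∉ P → c p ≤ 1 / 128 := fun p hp => by
    have hp2 : p ∉ P₂ := fun h => hp (by simp [hP, h])
    have := hP₂ {p} (by simpa using hp2)
    rw [Finset.sum_singleton] at this
    exact le_of_sq_le_sq this (by norm_num)
  have key := exists_finset_le_sum_of_tendsto hx hxc hxs hlim
  obtain ⟨σA, hσA, -, A, hA, hαA, -⟩ := key P 1 one_lt_two one_pos
  obtain ⟨σB, hσB, hσBA, B, hB, hβB, -⟩ := key (P ∪ A) 1 hσA one_pos
  obtain ⟨σ, hσ, hσσB, D, hD, hX, hrest⟩ := key (P ∪ A ∪ B)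
    (‖v‖ + ∑ p ∈ A, c p + ∑ p ∈ B, c p + ∑ p ∈ P, (c p + E p)) hσB
    (show (0 : ℝ) < 1 / 128 by norm_num)
  refine ⟨σ, hσ, exists_unit_tsum_eq (hx σ hσ) (hxs σ hσ) hEs (hr σ hσ) (hr' σ hσ) hA hB hD
    (fun p hp => (hxc σ hσ p).trans (hcP p hp))
    (fun F hF => hP₁ F (hF.mono_right Finset.subset_union_left)) hrest
    (hαA.trans (Finset.sum_le_sum fun p _ => hxanti _ _ (hσσB.trans hσBA).le p))
    (hβB.trans (Finset.sum_le_sum fun p _ => hxanti _ _ hσσB.le p)) (le_trans ?_ hX)⟩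
  gcongr
  exacts [hxc σ hσ _, hxc σ hσ _, hxc σ hσ _]

theorem norm_pow_sub_pow_le_of_norm_le_one {z w : ℂ} (hz : ‖z‖ ≤ 1) (hw : ‖w‖ ≤ 1) (n : ℕ) :
    ‖z ^ n - w ^ n‖ ≤ n * ‖z - w‖ := by
  induction n with
  | zero => simp
  | succ n ih =>
    rw [show z ^ (n + 1) - w ^ (n + 1) = z * (z ^ n - w ^ n) + (z - w) * w ^ n by ring]
    refine (norm_add_le _ _).trans ?_
    rw [norm_mul, norm_mul, norm_pow]
    have h1 := mul_le_mul hz ih (norm_nonneg _) zero_le_one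
    have h2 := mul_le_mul_of_nonneg_left (pow_le_one₀ (n := n) (norm_nonneg w) hw)
      (norm_nonneg (z - w))
    push_cast
    linarith

/-- The nonlinear part of an Euler factor of `log L(s) - log L(2s)` is Lipschitz in the twist, with a
constant of second order in `q`. -/
theorem norm_eulerFactor_remainder_sub_le {β : ℕ → ℂ} {K M q q₀ : ℝ} (hK : 0 ≤ K) (hM : M ≤ 1)
    (hMq : M ≤ q) (hqq₀ : q ≤ q₀) (hq₀ : 0 < q₀) (hq₀1 : q₀ < 1)
    (hβ : ∀ k, ‖β k‖ * M ^ (k + 1) ≤ K * q ^ (k + 1)) {u : ℂ} (hu : ‖u‖ ≤ M) {z w : ℂ}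
    (hz : ‖z‖ ≤ 1) (hw : ‖w‖ ≤ 1) :
    ‖(∑' k, β k * ((u * z) ^ (k + 1) - ((u * z) ^ (k + 1)) ^ 2) - β 0 * (u * z))
      - (∑' k, β k * ((u * w) ^ (k + 1) - ((u * w) ^ (k + 1)) ^ 2) - β 0 * (u * w))‖
      ≤ (3 * K / q₀ * ∑' k : ℕ, (k + 1) * q₀ ^ k) * q ^ 2 * ‖z - w‖ := by
  have hM0 : 0 ≤ M := (norm_nonneg u).trans hu
  have hq : 0 ≤ q := hM0.trans hMq
  have hq1 : q < 1 := hqq₀.trans_lt hq₀1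
  have hsum : ∀ z : ℂ, ‖z‖ ≤ 1 →
      Summable fun k => β k * ((u * z) ^ (k + 1) - ((u * z) ^ (k + 1)) ^ 2) := fun z hz => by
    have hgeom : Summable fun k : ℕ => 2 * (K * q ^ (k + 1)) :=
      (((summable_geometric_of_lt_one hq hq1).mul_right q).mul_left K).mul_left 2
    refine .of_norm_bounded hgeom fun k => ?_
    have huz : ‖u * z‖ ≤ M := by
      rw [norm_mul]
      simpa using mul_le_mul hu hz (norm_nonneg _) hM0
    rw [norm_mul]
    calc _ ≤ ‖β k‖ * (2 * M ^ (k + 1)) := by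
          gcongr
          exact norm_pow_sub_pow_sq_le huz hM _
      _ = 2 * (‖β k‖ * M ^ (k + 1)) := by ring
      _ ≤ _ := mul_le_mul_of_nonneg_left (hβ k) zero_le_two
  set G : ℂ → ℕ → ℂ := fun z k => β k * ((u * z) ^ (k + 1) - ((u * z) ^ (k + 1)) ^ 2)
    - if k = 0 then β 0 * (u * z) else 0 with hG
  have hGsum : ∀ z : ℂ, ‖z‖ ≤ 1 → HasSum (G z)
      (∑' k, β k * ((u * z) ^ (k + 1) - ((u * z) ^ (k + 1)) ^ 2) - β 0 * (u * z)) :=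
    fun z hz => (hsum z hz).hasSum.sub (hasSum_ite_eq 0 _)
  have hmaj : Summable fun k : ℕ => ((k : ℝ) + 1) * q₀ ^ k := by
    have h1 := summable_pow_mul_geometric_of_norm_lt_one 1
      (show ‖q₀‖ < 1 by rwa [Real.norm_of_nonneg hq₀.le])
    simpa [add_mul] using h1.add (summable_geometric_of_lt_one hq₀.le hq₀1)
  rw [← ((hGsum z hz).sub (hGsum w hw)).tsum_eq]
  refine tsum_of_norm_bounded (((hmaj.hasSum.mul_left (3 * K / q₀)).mul_right (q ^ 2)).mul_right
    ‖z - w‖) fun k => ?_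
  have hpow : ∀ n : ℕ, ‖u ^ n‖ ≤ M ^ n := fun n => by rw [norm_pow]; gcongr
  rcases k with _ | k
  · have h1 : G z 0 - G w 0 = -(β 0 * (u ^ 2 * (z ^ 2 - w ^ 2))) := by
      simp only [hG, if_true]
      ring
    rw [h1, norm_neg, norm_mul, norm_mul]
    have h2 := norm_pow_sub_pow_le_of_norm_le_one hz hw 2
    have h3 := hβ 0
    simp only [zero_add, pow_one] at h3
    calc _ ≤ ‖β 0‖ * (M ^ 2 * ((2 : ℕ) * ‖z - w‖)) := by gcongr; exact hpow 2
      _ = (‖β 0‖ * M) * M * (2 * ‖z - w‖) := by push_cast; ring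
      _ ≤ (K * q) * q * (2 * ‖z - w‖) := by gcongr
      _ = 2 * K * 1 * q ^ 2 * ‖z - w‖ := by ring
      _ ≤ 3 * K * (1 / q₀) * q ^ 2 * ‖z - w‖ := by
        gcongr
        · norm_num
        · rw [le_div_iff₀ hq₀]; linarith
      _ = _ := by simp only [Nat.cast_zero, zero_add, pow_zero]; ring
  · set n := k + 1 + 1 with hn
    have h1 : G z (k + 1) - G w (k + 1) = β (k + 1) *
        (u ^ n * (z ^ n - w ^ n) - (u ^ n) ^ 2 * (z ^ (n * 2) - w ^ (n * 2))) := by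
      simp only [hG, Nat.add_one_ne_zero, if_false, mul_pow, pow_mul]
      ring
    have h2 := norm_pow_sub_pow_le_of_norm_le_one hz hw n
    have h3 := norm_pow_sub_pow_le_of_norm_le_one hz hw (n * 2)
    have h4 : M ^ n ≤ 1 := pow_le_one₀ hM0 hM
    rw [h1, norm_mul]
    calc _ ≤ ‖β (k + 1)‖ * (‖u ^ n‖ * ‖z ^ n - w ^ n‖
          + ‖u ^ n‖ ^ 2 * ‖z ^ (n * 2) - w ^ (n * 2)‖) := by
          gcongr
          refine (norm_sub_le _ _).trans ?_
          rw [norm_mul, norm_mul, norm_pow (u ^ n)]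
      _ ≤ ‖β (k + 1)‖ * (M ^ n * (n * ‖z - w‖) + (M ^ n * 1) * ((n * 2 : ℕ) * ‖z - w‖)) := by
          gcongr
          · exact hpow n
          · rw [sq]
            gcongr
            exacts [hpow n, (hpow n).trans h4]
      _ = (‖β (k + 1)‖ * M ^ n) * (3 * n * ‖z - w‖) := by push_cast; ring
      _ ≤ (K * q ^ n) * (3 * n * ‖z - w‖) := 
          mul_le_mul_of_nonneg_right (hβ (k + 1)) (by positivity)
      _ = (K * (q ^ k * q ^ 2)) * (3 * n * ‖z - w‖) := by rw [hn]; ring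
      _ ≤ (K * (q₀ ^ k * q ^ 2)) * (3 * n * ‖z - w‖) := by gcongr
      _ = _ := by
          rw [hn]
          push_cast
          field_simp
          ring

theorem exists_norm_eq_one_mul_eq_norm (z : ℂ) : ∃ η : ℂ, ‖η‖ = 1 ∧ z * η = ‖z‖ := by
  refine ⟨cexp (((-arg z : ℝ) : ℂ) * I), norm_exp_ofReal_mul_I _, ?_⟩
  conv_lhs => rw [← norm_mul_exp_arg_mul_I z]
  rw [mul_assoc, ← Complex.exp_add]
  simp

/-- Every complex number is a value of a twist of `log L(s) - log L(2s)` to the right of `1`. -/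
theorem exists_twistedLogQuotient_eq {b : ℕ → ℕ → ℂ} {K θ : ℝ} (hK : 0 ≤ K) (hθ0 : 0 ≤ θ)
    (hθ : θ < 1 / 2)
    (hb : ∀ σ : ℝ, 1 < σ → Summable (fun pk : Nat.Primes × ℕ =>
      ‖b pk.1 (pk.2 + 1)‖ * (((pk.1 : ℕ) : ℝ) ^ (-σ)) ^ (pk.2 + 1)))
    (hbd : ∀ (p : Nat.Primes) (k : ℕ), ‖b p (k + 1)‖ ≤ K * (((p : ℕ) : ℝ) ^ θ) ^ (k + 1))
    (hlim : Tendsto (fun σ : ℝ => ∑' p : Nat.Primes, ‖b p 1‖ * ((p : ℕ) : ℝ) ^ (-σ))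
      (nhdsWithin 1 (Set.Ioi 1)) atTop) (v : ℂ) :
    ∃ σ : ℝ, 1 < σ ∧ ∃ χ : Nat.Primes → ℂ, (∀ p, ‖χ p‖ = 1) ∧ twistedLogQuotient b χ σ = v := by
  choose η hη hbη using fun p : Nat.Primes => exists_norm_eq_one_mul_eq_norm (b p 1)
  set u : ℝ → Nat.Primes → ℂ := fun σ p => η p * ((p : ℕ) : ℂ) ^ (-(σ : ℂ)) with hu
  have hu1 : ∀ σ p, ‖u σ p‖ = ((p : ℕ) : ℝ) ^ (-σ) := fun σ p => by
    rw [hu, norm_mul, hη, one_mul, norm_prime_cpow_neg, ofReal_re]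
  have hp1 : ∀ p : Nat.Primes, (1 : ℝ) ≤ (p : ℕ) := fun p => by exact_mod_cast p.2.one_le
  have hp0 : ∀ p : Nat.Primes, (0 : ℝ) < (p : ℕ) := fun p => zero_lt_one.trans_le (hp1 p)
  set q : Nat.Primes → ℝ := fun p => ((p : ℕ) : ℝ) ^ (θ - 1) with hq
  set q₀ : ℝ := 2 ^ (θ - 1) with hq₀
  have hq₀0 : 0 < q₀ := by positivity
  have hq₀1 : q₀ < 1 := Real.rpow_lt_one_of_one_lt_of_neg one_lt_two (by linarith)
  have hqq₀ : ∀ p, q p ≤ q₀ := fun p =>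
    Real.rpow_le_rpow_of_nonpos two_pos (by exact_mod_cast p.2.two_le) (by linarith)
  have hMq : ∀ p : Nat.Primes, ((p : ℕ) : ℝ) ^ (-1 : ℝ) ≤ q p := fun p =>
    Real.rpow_le_rpow_of_exponent_le (hp1 p) (by linarith)
  have hqθ : ∀ p : Nat.Primes, ((p : ℕ) : ℝ) ^ θ * ((p : ℕ) : ℝ) ^ (-1 : ℝ) = q p := fun p => by
    rw [← Real.rpow_add (hp0 p), ← sub_eq_add_neg]
  have hq2 : Summable fun p => q p ^ 2 := by
    have : ∀ p, q p ^ 2 = ((p : ℕ) : ℝ) ^ (2 * θ - 2) := fun p => by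
      rw [hq, ← Real.rpow_natCast, ← Real.rpow_mul (hp0 p).le]
      congr 1
      push_cast
      ring
    simp only [this]
    exact Nat.Primes.summable_rpow.2 (by linarith)
  have hβ : ∀ (p : Nat.Primes) (k : ℕ),
      ‖b p (k + 1)‖ * (((p : ℕ) : ℝ) ^ (-1 : ℝ)) ^ (k + 1) ≤ K * q p ^ (k + 1) := fun p k => by
    rw [← hqθ, mul_pow, ← mul_assoc]
    gcongr
    exact hbd p k
  set C : ℝ := 3 * K / q₀ * ∑' k : ℕ, (k + 1) * q₀ ^ k with hC
  have hM : ∀ {σ : ℝ}, 1 < σ → ∀ p : Nat.Primes,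
      ((p : ℕ) : ℝ) ^ (-σ) ≤ ((p : ℕ) : ℝ) ^ (-1 : ℝ) := fun hσ p =>
    Real.rpow_le_rpow_of_exponent_le (hp1 p) (by linarith)
  set r : ℝ → Nat.Primes → ℂ → ℂ := fun σ p z =>
    ∑' k, b p (k + 1) * ((u σ p * z) ^ (k + 1) - ((u σ p * z) ^ (k + 1)) ^ 2)
      - b p 1 * (u σ p * z) with hr
  have hlip : ∀ σ, 1 < σ → ∀ p (z w : ℂ), ‖z‖ ≤ 1 → ‖w‖ ≤ 1 →
      ‖r σ p z - r σ p w‖ ≤ C * q p ^ 2 * ‖z - w‖ := fun σ hσ p z w hz hw =>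
    norm_eulerFactor_remainder_sub_le (β := fun k => b p (k + 1)) hK
      (prime_rpow_neg_le_one p zero_le_one) (hMq p) (hqq₀ p) hq₀0 hq₀1 (hβ p)
      ((hu1 σ p).le.trans (hM hσ p)) hz hw
  have hxs : ∀ σ : ℝ, 1 < σ → Summable fun p : Nat.Primes => ‖b p 1‖ * ((p : ℕ) : ℝ) ^ (-σ) :=
    fun σ hσ => by
      simpa [Function.comp_def] using (hb σ hσ).comp_injective
        (i := fun p : Nat.Primes => (p, 0)) fun p p' h => congrArg Prod.fst h
  obtain ⟨σ, hσ, ω, hω, hv⟩ := exists_unit_tsum_eq_of_tendsto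
    (x := fun σ (p : Nat.Primes) => ‖b p 1‖ * ((p : ℕ) : ℝ) ^ (-σ)) (c := fun p => K * q p)
    (E := fun p => C * q p ^ 2) (r := r) (fun σ _ p => by positivity)
    (fun σ hσ p => by
      have := hβ p 0
      rw [zero_add, pow_one, pow_one] at this
      exact (mul_le_mul_of_nonneg_left (hM hσ p) (norm_nonneg _)).trans this)
    (fun σ₁ σ₂ h p => mul_le_mul_of_nonneg_left
      (Real.rpow_le_rpow_of_exponent_le (hp1 p) (by linarith)) (norm_nonneg _))
    hxs hlim (by simpa only [mul_pow] using hq2.mul_left (K ^ 2)) (hq2.mul_left C)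
    (fun σ hσ p z hz => by
      have h0 : r σ p 0 = 0 := by simp [hr]
      simpa [h0, hz] using hlip σ hσ p z 0 hz.le (by simp))
    (fun σ hσ p z w hz hw => hlip σ hσ p z w hz.le hw.le) v
  have hχ : ∀ p, ‖η p * ω p‖ = 1 := fun p => by rw [norm_mul, hη, hω, one_mul]
  refine ⟨σ, hσ, fun p => η p * ω p, hχ, ?_⟩
  rw [← hv, twistedLogQuotient, (summable_twistedLogQuotient hb hχ (by simpa using hσ)).tsum_prod]
  refine tsum_congr fun p => ?_
  have h1 : η p * ω p * ((p : ℕ) : ℂ) ^ (-(σ : ℂ)) = u σ p * ω p := by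
    simp only [hu]
    ring
  have h2 : b p 1 * (u σ p * ω p) = ((‖b p 1‖ * ((p : ℕ) : ℝ) ^ (-σ) : ℝ) : ℂ) * ω p := by
    rw [ofReal_mul, ← hbη, ofReal_cpow (hp0 p).le]
    push_cast
    simp only [hu]
    ring
  simp only [h1, hr, ← h2]
  ring

/-- **Theorem (case N = 2).** If `L(s) = ∑ a(n) n^{-s}` satisfies hypotheses (I), (II), (III),
then `L(s) + L(2s)` has infinitely many zeros in the half-plane `Re s > 1`. -/
theorem LSeries_add_double_infinite_zeros
    (a : ℕ → ℂ) (b : ℕ → ℕ → ℂ) (K θ : ℝ) (hK : 0 < K) (hθ : θ < 1 / 2)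
    -- (I) absolute convergence for Re s > 1
    (hI : ∀ s : ℂ, 1 < s.re → LSeriesSummable a s)
    -- (II) Euler product / logarithm: absolute convergence of the double series
    (hII_sum : ∀ s : ℂ, 1 < s.re →
      Summable (fun pk : Nat.Primes × ℕ =>
        ‖b pk.1 (pk.2 + 1) * ((pk.1 : ℕ) : ℂ) ^ (-(((pk.2 : ℕ) + 1 : ℕ) : ℂ) * s)‖))
    -- (II) exp of the double series equals L(s)
    (hII_exp : ∀ s : ℂ, 1 < s.re →
      Complex.exp (∑' pk : Nat.Primes × ℕ,
        b pk.1 (pk.2 + 1) * ((pk.1 : ℕ) : ℂ) ^ (-(((pk.2 : ℕ) + 1 : ℕ) : ℂ) * s)) = LSeries a s)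
    -- (II) bound on the coefficients b(p^k)
    (hII_bd : ∀ p : ℕ, p.Prime → ∀ k : ℕ, 1 ≤ k → ‖b p k‖ ≤ K * (p : ℝ) ^ ((k : ℝ) * θ))
    -- (III) the sum over primes of |a(p)| p^{-σ} tends to infinity as σ → 1⁺
    (hIII : Tendsto (fun σ : ℝ => ∑' p : Nat.Primes, ‖a (p : ℕ)‖ * ((p : ℕ) : ℝ) ^ (-σ))
      (nhdsWithin 1 (Set.Ioi 1)) atTop) :
    {s : ℂ | 1 < s.re ∧ LSeries a s + LSeries a (2 * s) = 0}.Infinite := by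
  have hpne : ∀ p : Nat.Primes, ((p : ℕ) : ℂ) ≠ 0 := fun p => by exact_mod_cast p.2.ne_zero
  have hterm : ∀ (s : ℂ) (pk : Nat.Primes × ℕ),
      ((pk.1 : ℕ) : ℂ) ^ (-(((pk.2 : ℕ) + 1 : ℕ) : ℂ) * s)
        = (((pk.1 : ℕ) : ℂ) ^ (-s)) ^ (pk.2 + 1) := fun s pk => by
    rw [← cpow_nat_mul]
    ring_nf
  simp only [hterm] at hII_sum hII_exp
  have hb : ∀ σ : ℝ, 1 < σ → Summable (fun pk : Nat.Primes × ℕ =>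
      ‖b pk.1 (pk.2 + 1)‖ * (((pk.1 : ℕ) : ℝ) ^ (-σ)) ^ (pk.2 + 1)) := fun σ hσ => by
    simpa only [norm_mul, norm_pow, norm_prime_cpow_neg, ofReal_re] using hII_sum σ hσ
  have hcoeff := coeff_prime_eq_mul_of_exp_eq a b hI (fun s hs => (hII_sum s hs).of_norm) hII_exp
  have hlim : Tendsto (fun σ : ℝ => ∑' p : Nat.Primes, ‖b p 1‖ * ((p : ℕ) : ℝ) ^ (-σ))
      (nhdsWithin 1 (Set.Ioi 1)) atTop := by
    simp only [hcoeff, norm_mul, mul_assoc, tsum_mul_left] at hIII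
    rcases (norm_nonneg (a 1)).eq_or_lt with h0 | h0
    · simp only [← h0, zero_mul] at hIII
      exact absurd tendsto_const_nhds (not_tendsto_nhds_of_tendsto_atTop hIII 0)
    · exact (tendsto_const_mul_atTop_of_pos h0).1 hIII
  obtain ⟨σ, hσ, χ, hχ, hv⟩ := exists_twistedLogQuotient_eq hK.le (le_max_right θ 0)
    (max_lt hθ (by norm_num)) hb (fun p k => by
      refine (hII_bd p p.2 (k + 1) (by omega)).trans ?_
      rw [← Real.rpow_mul_natCast (by positivity), mul_comm (max θ 0)]
      gcongr
      · exact_mod_cast p.2.one_le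
      · exact le_max_left θ 0) hlim (Real.pi * I)
  have hzero : ∀ s : ℂ, 1 < s.re → twistedLogQuotient b 1 s = Real.pi * I →
      LSeries a s + LSeries a (2 * s) = 0 := by
    intro s hs hs1
    have hs2 : 1 < (2 * s).re := by simp; linarith
    have hsq : ∀ p : Nat.Primes, ((p : ℕ) : ℂ) ^ (-(2 * s)) = (((p : ℕ) : ℂ) ^ (-s)) ^ 2 :=
      fun p => by rw [← cpow_nat_mul]; congr 1; push_cast; ring
    have hquot : (∑' pk : Nat.Primes × ℕ, b pk.1 (pk.2 + 1) *
          (((pk.1 : ℕ) : ℂ) ^ (-s)) ^ (pk.2 + 1))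
        - (∑' pk : Nat.Primes × ℕ, b pk.1 (pk.2 + 1) *
          (((pk.1 : ℕ) : ℂ) ^ (-(2 * s))) ^ (pk.2 + 1)) = Real.pi * I := by
      rw [← (hII_sum s hs).of_norm.tsum_sub (hII_sum _ hs2).of_norm, ← hs1]
      refine tsum_congr fun pk => ?_
      rw [hsq, Pi.one_apply]
      ring
    rw [← hII_exp s hs, ← hII_exp _ hs2, eq_add_of_sub_eq hquot, Complex.exp_add, exp_pi_mul_I]
    ring
  intro hfin
  obtain ⟨T, hT⟩ := (hfin.image im).bddAbove
  obtain ⟨s, hs, hsT, hs1⟩ := exists_twistedLogQuotient_eq_of_twist hb hχ hσ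
    (by simp [Real.pi_ne_zero]) hv (T + 1)
  have := hT ⟨s, ⟨hs, hzero s hs hs1⟩, rfl⟩
  linarith
end

section
/- Let L(s) = Σ_{n≥1} a(n) n^{-s} be a Dirichlet series satisfying hypotheses (I), (II), (III). Let f(s) = Σ_{n≥1} c(n) n^{-s} be a Dirichlet series converging absolutely for Re(s) ≥ 1, and assume there exist a constant B > 0 and a continuous function g on the closed half-plane Re(s) ≥ 1 such that exp(g(s)) = f(s) and |g(s)| ≤ B for all s with Re(s) ≥ 1 (i.e., f has a uniformly bounded logarithm for Re(s) ≥ 1). Then the function s ↦ L(s) + f(s) has infinitely many zeros in the half-plane Re(s) > 1; that is, the set {s ∈ ℂ : Re(s) > 1 and L(s) + f(s) = 0} is infinite. -/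
open Complex Filter

/-- The identity map of a circle around `0` has no continuous logarithm. -/
theorem not_exists_continuous_log_circle {R : ℝ} (hR : 0 < R) (h : ℝ → ℂ) (hc : Continuous h)
    (hper : h (2 * Real.pi) = h 0) (hexp : ∀ t, exp (h t) = R * exp (t * I)) : False := by
  have hR' : (R : ℂ) = exp (Real.log R) := by
    rw [← ofReal_exp, Real.exp_log hR]
  have hmem : ∀ t, ∃ n : ℤ, (h t - (Real.log R + t * I)) / (2 * Real.pi * I) = n := by
    intro t
    have := hexp t
    rw [hR', ← exp_add, exp_eq_exp_iff_exists_int] at this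
    obtain ⟨n, hn⟩ := this
    refine ⟨n, ?_⟩
    rw [hn, div_eq_iff two_pi_I_ne_zero]
    ring
  choose m hm using hmem
  have hcm : Continuous fun t => ((m t : ℤ) : ℝ) := by
    have : (fun t => ((m t : ℤ) : ℝ)) = fun t =>
        ((h t - (Real.log R + t * I)) / (2 * Real.pi * I)).re := by
      ext t
      rw [hm]
      simp
    rw [this]
    fun_prop
  have hcm' : Continuous m := Int.isClosedEmbedding_coe_real.isEmbedding.continuous_iff.2 hcm
  have hconst : m (2 * Real.pi) = m 0 := PreconnectedSpace.constant inferInstance hcm'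
  have h0 := hm 0
  have h1 := hm (2 * Real.pi)
  rw [hconst, ← h0, div_left_inj' two_pi_I_ne_zero, hper] at h1
  have : (2 * Real.pi * I : ℂ) = 0 := by
    push_cast at h1
    linear_combination -h1
  exact two_pi_I_ne_zero this

/-- A continuous map of the plane that moves every point of a circle around `0` by less than the
radius vanishes somewhere inside. -/
theorem exists_zero_of_norm_sub_lt {R : ℝ} (hR : 0 < R) {φ : ℂ → ℂ} (hφ : Continuous φ)
    (h : ∀ z, ‖z‖ = R → ‖φ z - z‖ < R) : ∃ z, ‖z‖ ≤ R ∧ φ z = 0 := by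
  by_contra! hne
  -- radial retraction onto the closed disc
  let ρ : ℂ → ℂ := fun z => ((R / max R ‖z‖ : ℝ) : ℂ) * z
  have hmax : ∀ z : ℂ, 0 < max R ‖z‖ := fun z => lt_max_of_lt_left hR
  have hρc : Continuous ρ := by
    refine Continuous.mul (continuous_ofReal.comp ?_) continuous_id
    exact continuous_const.div (by fun_prop) fun z => (hmax z).ne'
  have hρ : ∀ z, ‖ρ z‖ ≤ R := by
    intro z
    simp only [ρ, norm_mul, norm_real, Real.norm_eq_abs]
    rw [abs_of_nonneg (div_nonneg hR.le (hmax z).le), div_mul_eq_mul_div, div_le_iff₀ (hmax z)]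
    exact mul_le_mul_of_nonneg_left (le_max_right _ _) hR.le
  have hρR : ∀ z, ‖z‖ = R → ρ z = z := by
    intro z hz
    simp [ρ, hz, hR.ne']
  have hsc : IsSimplyConnected (Set.univ : Set ℂ) := by
    have : ContractibleSpace (Set.univ : Set ℂ) :=
      (convex_univ (𝕜 := ℝ)).contractibleSpace Set.univ_nonempty
    exact (inferInstance : SimplyConnectedSpace (Set.univ : Set ℂ))
  obtain ⟨ℓ, hℓc, hℓ⟩ := exists_continuousOn_eqOn_exp_comp hsc isOpen_univ
    (g := φ ∘ ρ) (hφ.comp hρc).continuousOn (by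
      rintro ⟨z, -, hz⟩
      exact hne _ (hρ z) hz)
  rw [continuousOn_univ] at hℓc
  let γ : ℝ → ℂ := fun t => R * exp (t * I)
  have hγc : Continuous γ := by fun_prop
  have hγn : ∀ t, ‖γ t‖ = R := fun t => by
    simp [γ, norm_exp_ofReal_mul_I, abs_of_pos hR]
  have hγ0 : ∀ t, γ t ≠ 0 := fun t => norm_pos_iff.1 (by rw [hγn]; exact hR)
  have hslit : ∀ t, φ (γ t) / γ t ∈ slitPlane := by
    intro t
    refine mem_slitPlane_of_norm_lt_one (z := φ (γ t) / γ t - 1) ?_ |> fun h => by simpa using h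
    rw [div_sub_one (hγ0 t), norm_div, hγn, div_lt_one hR]
    exact h _ (hγn t)
  refine not_exists_continuous_log_circle hR
    (fun t => ℓ (γ t) - log (φ (γ t) / γ t)) ?_ ?_ ?_
  · refine (hℓc.comp hγc).sub ?_
    exact ((hφ.comp hγc).div hγc hγ0).clog hslit
  · have : γ (2 * Real.pi) = γ 0 := by simp [γ]
    simp only [this]
  · intro t
    have h1 := hℓ (Set.mem_univ (γ t))
    simp only [Function.comp_apply, hρR _ (hγn t)] at h1
    rw [exp_sub, h1, exp_log (slitPlane_ne_zero (hslit t))]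
    have : φ (γ t) ≠ 0 := hne _ (hγn t).le
    field_simp [hγ0 t]
    rfl

open MeasureTheory in
theorem UnitAddTorus.volume_real_univ {ι : Type*} [Fintype ι] :
    (volume : Measure (UnitAddTorus ι)).real Set.univ = 1 := by
  simp [measureReal_def, volume_pi, Measure.pi_univ]

open MeasureTheory UnitAddTorus in
/-- Nontrivial characters of the torus have mean zero. -/
theorem UnitAddTorus.integral_mFourier_of_ne_zero {ι : Type*} [Fintype ι] {n : ι → ℤ}
    (hn : n ≠ 0) : ∫ x : UnitAddTorus ι, mFourier n x = 0 := by
  obtain ⟨i, hi⟩ := Function.ne_iff.1 hn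
  have hprod : ∫ x : UnitAddTorus ι, mFourier n x
      = ∏ i, ∫ x : UnitAddCircle, fourier (n i) x :=
    integral_fintype_prod_volume_eq_prod (fun i (x : UnitAddCircle) => fourier (n i) x)
  rw [hprod]
  refine Finset.prod_eq_zero (Finset.mem_univ i) ?_
  exact integral_eq_zero_of_add_right_eq_neg (fun x =>
    fourier_add_half_inv_index hi (by norm_num) x)

open MeasureTheory UnitAddTorus Topology in
/-- A linear flow with rationally independent frequencies equidistributes against trigonometric
polynomials on the torus. -/
theorem UnitAddTorus.tendsto_mean_of_mem_span {ι : Type*} [Fintype ι] {l : ι → ℝ}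
    (hl : ∀ m : ι → ℤ, ∑ i, m i * l i = 0 → m = 0) (T : ℝ)
    {F : C(UnitAddTorus ι, ℂ)} (hF : F ∈ Submodule.span ℂ (Set.range (mFourier (d := ι)))) :
    Tendsto (fun N : ℕ => (N : ℂ)⁻¹ * ∫ t in T..(T + N),
      F (fun i => ((l i * t : ℝ) : UnitAddCircle)))
      atTop (𝓝 (∫ x, F x)) := by
  have hcont : ∀ F : C(UnitAddTorus ι, ℂ),
      Continuous fun t : ℝ => F (fun i => ((l i * t : ℝ) : UnitAddCircle)) := fun F =>
    F.continuous.comp (continuous_pi fun i =>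
      (AddCircle.continuous_mk' 1).comp (continuous_const.mul continuous_id))
  have hint : ∀ F : C(UnitAddTorus ι, ℂ), Integrable F := fun F =>
    F.continuous.integrable_of_hasCompactSupport (HasCompactSupport.of_compactSpace _)
  induction hF using Submodule.span_induction with
  | mem F hF =>
    obtain ⟨n, rfl⟩ := hF
    rcases eq_or_ne n 0 with rfl | hn
    · simp only [mFourier_zero, ContinuousMap.one_apply, intervalIntegral.integral_const,
        add_sub_cancel_left, integral_const, UnitAddTorus.volume_real_univ, one_smul]
      refine tendsto_const_nhds.congr' ?_
      filter_upwards [eventually_gt_atTop 0] with N hN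
      have : (N : ℂ) ≠ 0 := by exact_mod_cast hN.ne'
      simp [this]
    · rw [integral_mFourier_of_ne_zero hn]
      set w : ℝ := 2 * Real.pi * ∑ i, n i * l i with hw
      have hw0 : w ≠ 0 := mul_ne_zero Real.two_pi_pos.ne' fun h => hn (hl n h)
      have hwI : (w * I : ℂ) ≠ 0 := mul_ne_zero (by exact_mod_cast hw0) I_ne_zero
      have hterm : ∀ t : ℝ, mFourier n (fun i => ((l i * t : ℝ) : UnitAddCircle))
          = exp (w * I * t) := by
        intro t
        simp only [mFourier, ContinuousMap.coe_mk, fourier_coe_apply]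
        rw [← exp_sum]
        congr 1
        simp only [hw]
        push_cast
        simp only [Finset.mul_sum, Finset.sum_mul]
        refine Finset.sum_congr rfl fun i _ => ?_
        simp
        ring
      simp only [hterm, integral_exp_mul_complex hwI]
      refine squeeze_zero_norm (a := fun N : ℕ => (N : ℝ)⁻¹ * (2 / |w|)) ?_ ?_
      · intro N
        rw [norm_mul, norm_inv, Complex.norm_natCast, norm_div]
        refine mul_le_mul_of_nonneg_left ?_ (by positivity)
        have h1 : ‖(w * I : ℂ)‖ = |w| := by simp
        rw [h1]
        refine div_le_div_of_nonneg_right ?_ (abs_nonneg _)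
        refine (norm_sub_le _ _).trans ?_
        have h2 : ∀ x : ℝ, ‖exp (w * I * x)‖ = 1 := by
          intro x
          rw [show (w * I * x : ℂ) = ((w * x : ℝ) : ℂ) * I by push_cast; ring]
          exact norm_exp_ofReal_mul_I _
        rw [h2, h2]
        norm_num
      · simpa using (tendsto_inv_atTop_nhds_zero_nat (𝕜 := ℝ)).mul_const (2 / |w|)
  | zero => simp
  | add F G _ _ hF hG =>
    simp only [ContinuousMap.add_apply]
    rw [integral_add (hint F) (hint G)]
    refine (hF.add hG).congr fun N => ?_
    rw [intervalIntegral.integral_add ((hcont F).intervalIntegrable _ _)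
      ((hcont G).intervalIntegrable _ _)]
    ring
  | smul c F _ hF =>
    simp only [ContinuousMap.smul_apply, smul_eq_mul]
    rw [integral_const_mul]
    refine (hF.const_mul c).congr fun N => ?_
    rw [intervalIntegral.integral_const_mul]
    ring

open MeasureTheory UnitAddTorus Topology in
/-- **Kronecker's approximation theorem**: a linear flow with rationally independent frequencies
comes arbitrarily close to any point of the torus, at arbitrarily late times. -/
theorem exists_ge_forall_norm_exp_sub_lt {ι : Type*} [Fintype ι] {l : ι → ℝ}
    (hl : ∀ m : ι → ℤ, ∑ i, m i * l i = 0 → m = 0) (w : ι → Circle) {ε : ℝ} (hε : 0 < ε) (T : ℝ) :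
    ∃ t, T ≤ t ∧ ∀ i, ‖exp (2 * Real.pi * (l i * t) * I) - w i‖ < ε := by
  by_contra! hcon
  let ψ : UnitAddTorus ι → ℝ := fun x => ∏ i, max 0 (ε - ‖(AddCircle.toCircle (x i) : ℂ) - w i‖)
  have hψc : Continuous ψ := by
    refine continuous_finsetProd _ fun i _ => continuous_const.max (continuous_const.sub ?_)
    refine (Continuous.sub ?_ continuous_const).norm
    exact continuous_subtype_val.comp (AddCircle.continuous_toCircle.comp (continuous_apply i))
  have hψ0 : 0 ≤ ψ := fun x => Finset.prod_nonneg fun i _ => le_max_left _ _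
  have hsurj : ∀ i, ∃ x : UnitAddCircle, AddCircle.toCircle x = w i := fun i => by
    obtain ⟨x, hx⟩ := (AddCircle.homeomorphCircle (one_ne_zero (α := ℝ))).surjective (w i)
    exact ⟨x, by rwa [AddCircle.homeomorphCircle_apply] at hx⟩
  choose x₀ hx₀ using hsurj
  have hψx : ψ x₀ ≠ 0 := by
    refine Finset.prod_ne_zero_iff.2 fun i _ => ?_
    simp [hx₀, hε.le, hε.ne']
  have hψi : Integrable ψ :=
    hψc.integrable_of_hasCompactSupport (HasCompactSupport.of_compactSpace _)
  have hpos : 0 < ∫ x, ψ x := integral_pos_of_integrable_nonneg_nonzero hψc hψi hψ0 hψx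
  obtain ⟨c, hc⟩ : ∃ c, c = ∫ x, ψ x := ⟨_, rfl⟩
  rw [← hc] at hpos
  have hψt : ∀ t, T ≤ t → ψ (fun i => ((l i * t : ℝ) : UnitAddCircle)) = 0 := by
    intro t ht
    obtain ⟨i, hi⟩ := hcon t ht
    refine Finset.prod_eq_zero (Finset.mem_univ i) (max_eq_left (sub_nonpos.2 ?_))
    convert hi using 4
    have := fourier_coe_apply (T := (1 : ℝ)) (n := 1) (x := l i * t)
    rw [fourier_one] at this
    rw [this]
    congr 1
    push_cast
    ring
  let Ψ : C(UnitAddTorus ι, ℂ) := ⟨fun x => (ψ x : ℂ), continuous_ofReal.comp hψc⟩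
  have hΨ : Ψ ∈ (Submodule.span ℂ (Set.range <| mFourier (d := ι))).topologicalClosure := by
    rw [span_mFourier_closure_eq_top]
    trivial
  obtain ⟨F, hF, hFΨ⟩ := Metric.mem_closure_iff.1 hΨ (c / 4) (div_pos hpos four_pos)
  have hb : ∀ x, ‖F x - Ψ x‖ ≤ c / 4 := fun x => by
    rw [← dist_eq_norm, dist_comm]
    exact (ContinuousMap.dist_apply_le_dist (f := Ψ) (g := F) x).trans hFΨ.le
  have hlim := tendsto_mean_of_mem_span hl T hF
  have hmean : ‖∫ x, F x‖ ≤ c / 4 := by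
    refine le_of_tendsto hlim.norm ?_
    filter_upwards [eventually_gt_atTop 0] with N hN
    have hN' : (0 : ℝ) < N := by exact_mod_cast hN
    have := intervalIntegral.norm_integral_le_of_norm_le_const (a := T) (b := T + N) (C := c / 4)
      (f := fun t => F (fun i => ((l i * t : ℝ) : UnitAddCircle))) (by
        intro t ht
        rw [Set.uIoc_of_le (by linarith)] at ht
        have h := hb (fun i => ((l i * t : ℝ) : UnitAddCircle))
        simpa [Ψ, hψt t ht.1.le] using h)
    rw [norm_mul, norm_inv, Complex.norm_natCast]
    rw [add_sub_cancel_left, abs_of_pos hN'] at this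
    rw [inv_mul_le_iff₀ hN']
    linarith
  have hdiff : ‖(∫ x, F x) - c‖ ≤ c / 4 := by
    have h1 : (c : ℂ) = ∫ x, Ψ x := by
      rw [hc]
      exact integral_ofReal.symm
    have hint : ∀ F : C(UnitAddTorus ι, ℂ), Integrable F := fun F =>
      F.continuous.integrable_of_hasCompactSupport (HasCompactSupport.of_compactSpace _)
    rw [h1, ← integral_sub (hint F) (hint Ψ)]
    have := norm_integral_le_of_norm_le_const (μ := (volume : Measure (UnitAddTorus ι)))
      (f := fun x => F x - Ψ x) (C := c / 4) (Eventually.of_forall hb)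
    rwa [volume_real_univ, mul_one] at this
  have : ‖(c : ℂ)‖ ≤ c / 4 + c / 4 := by
    calc ‖(c : ℂ)‖ = ‖(∫ x, F x) - ((∫ x, F x) - c)‖ := by simp
      _ ≤ _ := (norm_sub_le _ _).trans (add_le_add hmean hdiff)
  rw [norm_real, Real.norm_eq_abs, abs_of_pos hpos] at this
  linarith

/-- The logarithms of distinct primes are linearly independent over `ℤ`. -/
theorem Nat.eq_zero_of_sum_mul_log_primes_eq_zero {S : Finset ℕ} (hS : ∀ p ∈ S, p.Prime)
    {m : S → ℤ} (hm : ∑ p : S, (m p : ℝ) * Real.log (p : ℕ) = 0) : m = 0 := by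
  have hlog : ∀ e : S → ℕ, Real.log ((∏ p : S, (p : ℕ) ^ e p : ℕ) : ℝ)
      = ∑ p : S, (e p : ℝ) * Real.log (p : ℕ) := by
    intro e
    push_cast
    rw [Real.log_prod fun (p : S) _ => pow_ne_zero _ (Nat.cast_ne_zero.2 (hS p p.2).ne_zero)]
    simp
  have hpos : ∀ e : S → ℕ, (0 : ℝ) < (∏ p : S, (p : ℕ) ^ e p : ℕ) := fun e =>
    Nat.cast_pos.2 (Finset.prod_pos fun p _ => pow_pos (hS p p.2).pos _)
  have hfac : ∀ (e : S → ℕ) (q : S), (∏ p : S, (p : ℕ) ^ e p).factorization q = e q := by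
    intro e q
    rw [Nat.factorization_prod fun (p : S) _ => pow_ne_zero _ (hS p p.2).ne_zero,
      Finsupp.finsetSum_apply,
      Finset.sum_eq_single q]
    · simp [(hS q q.2).factorization]
    · intro p _ hpq
      simp [(hS p p.2).factorization, Subtype.coe_injective.ne hpq]
    · simp
  have heq : (∏ p : S, (p : ℕ) ^ (m p).toNat) = ∏ p : S, (p : ℕ) ^ (-m p).toNat := by
    refine Nat.cast_injective (R := ℝ) (Real.log_injOn_pos (hpos _) (hpos _) ?_)
    rw [hlog, hlog, ← sub_eq_zero, ← Finset.sum_sub_distrib, ← hm]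
    refine Finset.sum_congr rfl fun p _ => ?_
    rw [← sub_mul]
    congr 1
    exact_mod_cast Int.toNat_sub_toNat_neg (m p)
  ext q
  have h1 := hfac (fun p => (m p).toNat) q
  have h2 := hfac (fun p => (-m p).toNat) q
  rw [heq, h2] at h1
  simp only [Pi.zero_apply]
  omega

open Topology in
/-- The functions `p ↦ p ^ (-iτ)` on the primes approximate arbitrary unimodular functions,
as `τ → ∞`. -/
theorem exists_tendsto_prime_cpow (u : ℕ → Circle) :
    ∃ τ : ℕ → ℝ, Tendsto τ atTop atTop ∧
      ∀ p : ℕ, p.Prime → Tendsto (fun j => (p : ℂ) ^ (-(τ j * I))) atTop (𝓝 (u p)) := by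
  have key : ∀ j : ℕ, ∃ t : ℝ, j ≤ t ∧ ∀ p : ℕ, p.Prime → p < j →
      ‖(p : ℂ) ^ (-(t * I)) - u p‖ < 1 / ((j : ℝ) + 1) := by
    intro j
    let S : Finset ℕ := (Finset.range j).filter Nat.Prime
    have hS : ∀ p ∈ S, p.Prime := fun p hp => (Finset.mem_filter.1 hp).2
    obtain ⟨t, ht, h⟩ := exists_ge_forall_norm_exp_sub_lt (ι := S)
      (l := fun p => -Real.log (p : ℕ) / (2 * Real.pi)) (by
        intro m hm
        refine Nat.eq_zero_of_sum_mul_log_primes_eq_zero hS ?_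
        have : ∑ p : S, (m p : ℝ) * (-Real.log (p : ℕ) / (2 * Real.pi))
            = -(∑ p : S, (m p : ℝ) * Real.log (p : ℕ)) / (2 * Real.pi) := by
          rw [neg_div, Finset.sum_div, ← Finset.sum_neg_distrib]
          exact Finset.sum_congr rfl fun p _ => by ring
        rw [this] at hm
        simpa [Real.pi_ne_zero] using hm)
      (fun p => u p) (ε := 1 / ((j : ℝ) + 1)) (by positivity) j
    refine ⟨t, ht, fun p hp hpj => ?_⟩
    have := h ⟨p, Finset.mem_filter.2 ⟨Finset.mem_range.2 hpj, hp⟩⟩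
    rw [cpow_def_of_ne_zero (Nat.cast_ne_zero.2 hp.ne_zero), ← natCast_log]
    convert this using 4
    have : (Real.pi : ℂ) ≠ 0 := ofReal_ne_zero.2 Real.pi_ne_zero
    push_cast
    field_simp
  choose τ hτ h using key
  refine ⟨τ, tendsto_atTop_mono hτ tendsto_natCast_atTop_atTop, fun p hp => ?_⟩
  rw [tendsto_iff_norm_sub_tendsto_zero]
  refine squeeze_zero' (Eventually.of_forall fun _ => norm_nonneg _) ?_
    (tendsto_one_div_add_atTop_nhds_zero_nat (𝕜 := ℝ))
  filter_upwards [eventually_gt_atTop p] with j hj using (h j p hp hj).le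

/-- The completely multiplicative function with prescribed unimodular values at the primes. -/
noncomputable def Circle.twist (u : ℕ → Circle) (n : ℕ) : Circle :=
  n.factorization.prod fun p k => u p ^ k

theorem Circle.twist_prime_mul (u : ℕ → Circle) {p n : ℕ} (hp : p.Prime) (hn : n ≠ 0) :
    Circle.twist u (p * n) = u p * Circle.twist u n := by
  rw [twist, Nat.factorization_mul hp.ne_zero hn, Finsupp.prod_add_index' (by simp)
    fun _ _ _ => pow_add _ _ _, hp.factorization, Finsupp.prod_single_index (by simp),
      pow_one, twist]

theorem Circle.twist_eq_one {u : ℕ → Circle} {N n : ℕ} (hu : ∀ p ≤ N, u p = 1) (hn : n ≤ N) :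
    Circle.twist u n = 1 := by
  rw [twist, Finsupp.prod]
  exact Finset.prod_eq_one fun p hp => by
    rw [hu p ((Nat.le_of_mem_primeFactors hp).trans hn), one_pow]

theorem Circle.continuous_twist {X : Type*} [TopologicalSpace X] {u : X → ℕ → Circle}
    (hu : ∀ p, Continuous fun x => u x p) (n : ℕ) : Continuous fun x => Circle.twist (u x) n := by
  simp only [twist, Finsupp.prod]
  exact continuous_finsetProd _ fun p _ => (hu p).pow _

open Topology in
theorem Circle.tendsto_natCast_cpow_twist {u : ℕ → Circle} {τ : ℕ → ℝ}
    (hτ : ∀ p : ℕ, p.Prime → Tendsto (fun j => (p : ℂ) ^ (-(τ j * I))) atTop (𝓝 (u p)))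
    {n : ℕ} (hn : n ≠ 0) :
    Tendsto (fun j => (n : ℂ) ^ (-(τ j * I))) atTop (𝓝 (Circle.twist u n)) := by
  induction n using induction_on_primes with
  | zero => exact absurd rfl hn
  | one => simp [Circle.twist]
  | prime_mul p n hp ih =>
    have hn : n ≠ 0 := right_ne_zero_of_mul hn
    rw [Circle.twist_prime_mul u hp hn, Circle.coe_mul]
    refine ((hτ p hp).mul (ih hn)).congr fun j => ?_
    rw [Nat.cast_mul, natCast_mul_natCast_cpow]

theorem LSeries.term_add_mul_I (d : ℕ → ℂ) (s : ℂ) (t : ℝ) {n : ℕ} (hn : n ≠ 0) :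
    term d (s + t * I) n = term d s n * (n : ℂ) ^ (-(t * I)) := by
  rw [term_of_ne_zero hn, term_of_ne_zero hn, cpow_add _ _ (Nat.cast_ne_zero.2 hn), cpow_neg]
  field_simp

theorem LSeries.term_mul_right (d χ : ℕ → ℂ) (s : ℂ) (n : ℕ) :
    term (fun n => d n * χ n) s n = term d s n * χ n := by
  rcases eq_or_ne n 0 with rfl | hn
  · simp
  · rw [term_of_ne_zero hn, term_of_ne_zero hn, mul_div_right_comm]

theorem LSeriesSummable.mul_twist {d : ℕ → ℂ} {s : ℂ} (hd : LSeriesSummable d s)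
    (u : ℕ → Circle) : LSeriesSummable (fun n => d n * Circle.twist u n) s := by
  refine Summable.of_norm_bounded (Summable.norm hd) fun n => ?_
  rw [LSeries.term_mul_right d (fun n => (Circle.twist u n : ℂ)), norm_mul, Circle.norm_coe,
    mul_one]

open LSeries in
/-- Vertical shifts of an `L`-series converge, uniformly on half-planes, to a twisted `L`-series. -/
theorem LSeries.eventually_forall_norm_shift_sub_twist_lt {d : ℕ → ℂ} {x : ℝ}
    (hd : LSeriesSummable d x) {u : ℕ → Circle} {τ : ℕ → ℝ}
    (hτ : ∀ p : ℕ, p.Prime → Tendsto (fun j => (p : ℂ) ^ (-(τ j * I))) atTop (nhds (u p)))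
    {ε : ℝ} (hε : 0 < ε) :
    ∀ᶠ j in atTop, ∀ s : ℂ, x ≤ s.re →
      ‖LSeries d (s + τ j * I) - LSeries (fun n => d n * Circle.twist u n) s‖ < ε := by
  let B : ℕ → ℕ → ℝ := fun j n => ‖term d x n‖ * ‖(n : ℂ) ^ (-(τ j * I)) - Circle.twist u n‖
  have hcp : ∀ (j : ℕ) {n : ℕ}, n ≠ 0 → ‖(n : ℂ) ^ (-(τ j * I))‖ = 1 := by
    intro j n hn
    rw [norm_natCast_cpow_of_pos (Nat.pos_of_ne_zero hn)]
    simp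
  have hB2 : ∀ j n, ‖B j n‖ ≤ ‖term d x n‖ * 2 := by
    intro j n
    rcases eq_or_ne n 0 with rfl | hn
    · simp [B]
    simp only [B, norm_mul, norm_norm]
    refine mul_le_mul_of_nonneg_left ((norm_sub_le _ _).trans ?_) (norm_nonneg _)
    rw [hcp j hn, Circle.norm_coe]
    norm_num
  have hsum2 : Summable fun n => ‖term d x n‖ * 2 := (Summable.norm hd).mul_right 2
  have hBs : ∀ j, Summable (B j) := fun j => Summable.of_norm_bounded hsum2 (hB2 j)
  have hlim : Tendsto (fun j => ∑' n, B j n) atTop (nhds (∑' _ : ℕ, 0)) := by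
    refine tendsto_tsum_of_dominated_convergence hsum2 (fun n => ?_)
      (Eventually.of_forall fun j n => hB2 j n)
    rcases eq_or_ne n 0 with rfl | hn
    · simp [B]
    have := (Circle.tendsto_natCast_cpow_twist hτ hn).sub_const (Circle.twist u n : ℂ)
    simpa [B] using this.norm.const_mul ‖term d x n‖
  rw [tsum_zero] at hlim
  filter_upwards [hlim.eventually_lt_const hε] with j hj s hs
  refine lt_of_le_of_lt ?_ hj
  have hds : LSeriesSummable d s := hd.of_re_le_re (by simpa using hs)
  have hdt : LSeriesSummable d (s + τ j * I) := hd.of_re_le_re (by simpa using hs)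
  rw [LSeries, LSeries, ← Summable.tsum_sub hdt (hds.mul_twist u)]
  refine tsum_of_norm_bounded (hBs j).hasSum fun n => ?_
  rcases eq_or_ne n 0 with rfl | hn
  · simp [B]
  rw [term_mul_right d (fun n => (Circle.twist u n : ℂ)), term_add_mul_I d s _ hn, ← mul_sub,
    norm_mul]
  exact mul_le_mul_of_nonneg_right (norm_term_le_of_re_le_re d (by simpa using hs) n)
    (norm_nonneg _)

/-- The Euler product of a twisted `L`-series. -/
theorem LSeries.exp_tsum_twist {a : ℕ → ℂ} {b : ℕ → ℕ → ℂ}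
    (hI : ∀ s : ℂ, 1 < s.re → LSeriesSummable a s)
    (hsum : ∀ s : ℂ, 1 < s.re → Summable (fun pk : Nat.Primes × ℕ =>
        ‖b pk.1 (pk.2 + 1) * ((pk.1 : ℕ) : ℂ) ^ (-(((pk.2 : ℕ) + 1 : ℕ) : ℂ) * s)‖))
    (hexp : ∀ s : ℂ, 1 < s.re → Complex.exp (∑' pk : Nat.Primes × ℕ,
        b pk.1 (pk.2 + 1) * ((pk.1 : ℕ) : ℂ) ^ (-(((pk.2 : ℕ) + 1 : ℕ) : ℂ) * s)) = LSeries a s)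
    (u : ℕ → Circle) {σ : ℝ} (hσ : 1 < σ) :
    Complex.exp (∑' pk : Nat.Primes × ℕ, b pk.1 (pk.2 + 1) *
      ((pk.1 : ℕ) : ℂ) ^ (-(((pk.2 : ℕ) + 1 : ℕ) : ℂ) * σ) * (u pk.1 : ℂ) ^ (pk.2 + 1)) =
      LSeries (fun n => a n * Circle.twist u n) σ := by
  obtain ⟨τ, -, hτ⟩ := exists_tendsto_prime_cpow u
  have hre : ∀ j, 1 < ((σ : ℂ) + τ j * I).re := fun j => by simpa using hσ
  have h1 : Tendsto (fun j => LSeries a (σ + τ j * I)) atTop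
      (nhds (LSeries (fun n => a n * Circle.twist u n) σ)) := by
    rw [Metric.tendsto_nhds]
    intro ε hε
    filter_upwards [eventually_forall_norm_shift_sub_twist_lt (hI σ (by simpa using hσ)) hτ hε]
      with j hj
    rw [dist_eq_norm]
    exact hj σ (by simp)
  refine tendsto_nhds_unique ?_ h1
  simp_rw [← hexp _ (hre _)]
  refine (continuous_exp.tendsto _).comp ?_
  refine tendsto_tsum_of_dominated_convergence (hsum σ (by simpa using hσ)) (fun pk => ?_)
    (Eventually.of_forall fun j pk => ?_)
  all_goals
    have hp0 : ((pk.1 : ℕ) : ℂ) ≠ 0 := Nat.cast_ne_zero.2 pk.1.2.ne_zero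
    have hsplit : ∀ j, ((pk.1 : ℕ) : ℂ) ^ (-(((pk.2 : ℕ) + 1 : ℕ) : ℂ) * (σ + τ j * I))
        = ((pk.1 : ℕ) : ℂ) ^ (-(((pk.2 : ℕ) + 1 : ℕ) : ℂ) * σ) *
          (((pk.1 : ℕ) : ℂ) ^ (-(τ j * I))) ^ (pk.2 + 1) := by
      intro j
      rw [← cpow_nat_mul, ← cpow_add _ _ hp0]
      congr 1
      ring
  · simp only [hsplit, ← mul_assoc]
    exact ((hτ _ pk.1.2).pow _).const_mul _
  · rw [hsplit, ← mul_assoc, norm_mul, norm_pow, norm_natCast_cpow_of_pos pk.1.2.pos]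
    simp

open LSeries LSeries.notation in
/-- If `exp (∑ β(n) n^{-s}) = ∑ a(n) n^{-s}` with `β 1 = 0`, then `a p = a 1 * β p` for primes. -/
theorem LSeries.apply_prime_of_exp_eq {a β : ℕ → ℂ} (hβ1 : β 1 = 0) {x : ℝ}
    (ha : ∀ s : ℂ, x < s.re → LSeriesSummable a s)
    (hβ : ∀ s : ℂ, x < s.re → LSeriesSummable β s)
    (hexp : ∀ s : ℂ, x < s.re → exp (LSeries β s) = LSeries a s) {p : ℕ} (hp : p.Prime) :
    a p = a 1 * β p := by
  have habs : ∀ {f : ℕ → ℂ}, (∀ s : ℂ, x < s.re → LSeriesSummable f s) →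
      abscissaOfAbsConv f ≤ x := fun hf => abscissaOfAbsConv_le_of_forall_lt_LSeriesSummable
    fun y hy => hf y (by simpa using hy)
  have hconv : abscissaOfAbsConv (logMul β ⍟ a) ≤ x := by
    refine (abscissaOfAbsConv_convolution_le _ _).trans (max_le ?_ (habs ha))
    rw [abscissaOfAbsConv_logMul]
    exact habs hβ
  have hlt : ∀ {s : ℂ} {f : ℕ → ℂ}, x < s.re → abscissaOfAbsConv f ≤ x →
      abscissaOfAbsConv f < s.re := fun hs hf => hf.trans_lt (EReal.coe_lt_coe_iff.2 hs)
  have hderiv : ∀ s : ℂ, x < s.re → LSeries (logMul a) s = LSeries (logMul β ⍟ a) s := by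
    intro s hs
    have h1 : HasDerivAt (LSeries a) (-LSeries (logMul a) s) s :=
      LSeries_hasDerivAt (hlt hs (habs ha))
    have h2 : HasDerivAt (LSeries a) (exp (LSeries β s) * -LSeries (logMul β) s) s := by
      refine (LSeries_hasDerivAt (hlt hs (habs hβ))).cexp.congr_of_eventuallyEq ?_
      filter_upwards [(isOpen_lt continuous_const continuous_re).mem_nhds hs] with z hz
      exact (hexp z hz).symm
    have h3 := h1.unique h2
    rw [LSeries_convolution (hlt hs (by rw [abscissaOfAbsConv_logMul]; exact habs hβ))
      (hlt hs (habs ha)), ← hexp s hs]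
    linear_combination -h3
  have hev : (fun y : ℝ => LSeries (logMul a) y) =ᶠ[atTop]
    fun y : ℝ => LSeries (logMul β ⍟ a) y := by
    filter_upwards [eventually_gt_atTop x] with y hy
    exact hderiv y (by simpa using hy)
  have heq := LSeries.eq_of_LSeries_eventually_eq
    (by rw [abscissaOfAbsConv_logMul]; exact (habs ha).trans_lt (EReal.coe_lt_top x))
    (hconv.trans_lt (EReal.coe_lt_top x)) hev hp.ne_zero
  rw [convolution_def] at heq
  simp only [Nat.sum_divisorsAntidiagonal fun i j => logMul β i * a j, hp.sum_divisors,
    Nat.div_self hp.pos, logMul, hβ1] at heq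
  have hlog : log (p : ℂ) ≠ 0 := by
    rw [← natCast_log]
    exact ofReal_ne_zero.2 (Real.log_pos (by exact_mod_cast hp.one_lt)).ne'
  refine mul_left_cancel₀ hlog ?_
  linear_combination heq

/-- The coefficients at the primes of a Dirichlet series with an Euler product. -/
theorem LSeries.apply_prime_of_exp_tsum_eq {a : ℕ → ℂ} {b : ℕ → ℕ → ℂ}
    (hI : ∀ s : ℂ, 1 < s.re → LSeriesSummable a s)
    (hsum : ∀ s : ℂ, 1 < s.re → Summable (fun pk : Nat.Primes × ℕ =>
        ‖b pk.1 (pk.2 + 1) * ((pk.1 : ℕ) : ℂ) ^ (-(((pk.2 : ℕ) + 1 : ℕ) : ℂ) * s)‖))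
    (hexp : ∀ s : ℂ, 1 < s.re → Complex.exp (∑' pk : Nat.Primes × ℕ,
        b pk.1 (pk.2 + 1) * ((pk.1 : ℕ) : ℂ) ^ (-(((pk.2 : ℕ) + 1 : ℕ) : ℂ) * s)) = LSeries a s)
    {p : ℕ} (hp : p.Prime) : a p = a 1 * b p 1 := by
  classical
  let β : ℕ → ℂ := fun n => if IsPrimePow n then b n.minFac (n.factorization n.minFac) else 0
  have hβpow : ∀ (q : Nat.Primes) (k : ℕ), β ((q : ℕ) ^ (k + 1)) = b q (k + 1) := by
    intro q k
    have hq : IsPrimePow ((q : ℕ) ^ (k + 1)) := q.2.isPrimePow.pow k.succ_ne_zero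
    simp [β, hq, q.2.pow_minFac k.succ_ne_zero, q.2.factorization_self]
  let e : Nat.Primes × ℕ → ℕ := fun pk => (pk.1 : ℕ) ^ (pk.2 + 1)
  have he : Function.Injective e :=
    Subtype.val_injective.comp Nat.Primes.prodNatEquiv.injective
  have hterm : ∀ (s : ℂ) (pk : Nat.Primes × ℕ), term β s (e pk) =
      b pk.1 (pk.2 + 1) * ((pk.1 : ℕ) : ℂ) ^ (-(((pk.2 : ℕ) + 1 : ℕ) : ℂ) * s) := by
    intro s pk
    rw [term_of_ne_zero (pow_ne_zero _ pk.1.2.ne_zero), hβpow, div_eq_mul_inv, ← cpow_neg,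
      neg_mul, ← mul_neg, natCast_cpow_natCast_mul, Nat.cast_pow]
  have hsupp : ∀ s, ∀ n ∉ Set.range e, term β s n = 0 := by
    intro s n hn
    rcases eq_or_ne n 0 with rfl | hn0
    · simp
    rw [term_of_ne_zero hn0, show β n = 0 from if_neg fun h => hn ?_, zero_div]
    obtain ⟨pk, hpk⟩ := Nat.Primes.prodNatEquiv.surjective ⟨n, h⟩
    exact ⟨pk, congr_arg Subtype.val hpk⟩
  have hβs : ∀ s : ℂ, 1 < s.re → LSeriesSummable β s := by
    intro s hs
    rw [LSeriesSummable, ← he.summable_iff (hsupp s)]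
    exact (hsum s hs).of_norm.congr fun pk => (hterm s pk).symm
  have hβ1 : β 1 = 0 := if_neg not_isPrimePow_one
  have h := apply_prime_of_exp_eq (β := β) hβ1 hI hβs (fun s hs => by
    rw [← hexp s hs, LSeries, ← he.tsum_eq fun n hn => by_contra fun h => hn (hsupp s n h)]
    simp only [hterm]) hp
  rw [h, ← hβpow ⟨p, hp⟩ 0, zero_add, pow_one]

open Metric Topology in
/-- A quantitative form of Hurwitz's theorem. -/
theorem exists_zero_of_forall_norm_sub_lt {F G : ℂ → ℂ} {z₀ : ℂ} {r ε : ℝ} (hr : 0 < r)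
    (hε : 0 < ε) (hG : DiffContOnCl ℂ G (ball z₀ r)) (hF0 : F z₀ = 0)
    (hF : ∀ z ∈ sphere z₀ r, ε ≤ ‖F z‖) (hFG : ∀ z ∈ closedBall z₀ r, ‖G z - F z‖ < ε / 4) :
    ∃ z ∈ closedBall z₀ r, G z = 0 := by
  have h0 : ‖G z₀‖ < ε / 4 := by
    simpa [hF0] using hFG z₀ (mem_closedBall_self hr.le)
  have hs : ∀ z ∈ sphere z₀ r, ε / 2 ≤ ‖G z - G z₀‖ := by
    intro z hz
    have h1 := hF z hz
    have h2 := hFG z (sphere_subset_closedBall hz)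
    have h3 : ‖F z‖ ≤ ‖G z - G z₀‖ + ‖G z - F z‖ + ‖G z₀‖ := by
      calc ‖F z‖ = ‖(G z - G z₀) - (G z - F z) + G z₀‖ := by congr 1; ring
        _ ≤ _ := (norm_add_le _ _).trans (add_le_add_left (norm_sub_le _ _) _)
    linarith
  by_cases hfr : ∃ᶠ z in 𝓝 z₀, G z ≠ G z₀
  · obtain ⟨z, hz, hz0⟩ := hG.ball_subset_image_closedBall hr hs hfr
      (show (0 : ℂ) ∈ ball (G z₀) (ε / 2 / 2) by
        rw [mem_ball_iff_norm, zero_sub, norm_neg]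
        linarith)
    exact ⟨z, hz, hz0⟩
  · rw [not_frequently] at hfr
    -- `G` is then constant on the disc, which contradicts the lower bound on the circle
    exfalso
    have han : AnalyticOnNhd ℂ G (ball z₀ r) := hG.differentiableOn.analyticOnNhd isOpen_ball
    have heq : Set.EqOn G (fun _ => G z₀) (ball z₀ r) :=
      han.eqOn_of_preconnected_of_eventuallyEq analyticOnNhd_const
        (convex_ball z₀ r).isPreconnected (mem_ball_self hr)
        (hfr.mono fun z hz => not_not.1 hz)
    have hcl : Set.EqOn G (fun _ => G z₀) (closedBall z₀ r) := by
      rw [← closure_ball z₀ hr.ne']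
      exact heq.of_subset_closure hG.continuousOn continuousOn_const subset_closure le_rfl
    obtain ⟨z, hz⟩ := (NormedSpace.sphere_nonempty (x := z₀) (r := r)).2 hr.le
    have := hs z hz
    rw [hcl (sphere_subset_closedBall hz)] at this
    simp at this
    linarith

open Metric Topology LSeries in
/-- If some twist by a unimodular completely multiplicative function of a Dirichlet series has a
zero to the right of `1`, then the series itself has infinitely many zeros there. -/
theorem LSeries.infinite_zeros_of_twist_zero {d : ℕ → ℂ}
    (hd : ∀ s : ℂ, 1 < s.re → LSeriesSummable d s) (u : ℕ → Circle) {σ : ℝ} (hσ : 1 < σ)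
    (h0 : LSeries (fun n => d n * Circle.twist u n) σ = 0) :
    {s : ℂ | 1 < s.re ∧ LSeries d s = 0}.Infinite := by
  by_cases hdz : ∀ n ≠ 0, d n = 0
  · have hall : ∀ s, LSeries d s = 0 := fun s => by
      rw [LSeries_congr (g := 0) (fun {n} hn => hdz n hn) s, LSeries_zero, Pi.zero_apply]
    refine Set.infinite_of_injective_forall_mem (f := fun n : ℕ => (2 : ℂ) + n) (fun m n h => ?_)
      fun n => ⟨?_, hall _⟩
    · simpa using h
    · simp only [add_re, re_ofNat, natCast_re]
      have : (0 : ℝ) ≤ n := n.cast_nonneg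
      linarith
  set F := LSeries (fun n => d n * Circle.twist u n) with hFdef
  have habs : ∀ {f : ℕ → ℂ}, (∀ s : ℂ, 1 < s.re → LSeriesSummable f s) →
      abscissaOfAbsConv f ≤ (1 : ℝ) := fun hf => abscissaOfAbsConv_le_of_forall_lt_LSeriesSummable
    fun y hy => hf y (by simpa using hy)
  have hH : ∀ {f : ℕ → ℂ}, (∀ s : ℂ, 1 < s.re → LSeriesSummable f s) →
      AnalyticOnNhd ℂ (LSeries f) {s | 1 < s.re} := fun {f} hf s hs =>
    LSeries_analyticOnNhd f s ((habs hf).trans_lt (EReal.coe_lt_coe_iff.2 hs))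
  have hdu : ∀ s : ℂ, 1 < s.re → LSeriesSummable (fun n => d n * Circle.twist u n) s :=
    fun s hs => (hd s hs).mul_twist u
  have hFan := hH hdu
  have hconv : Convex ℝ {s : ℂ | 1 < s.re} := convex_halfSpace_re_gt 1
  have hσm : (σ : ℂ) ∈ {s : ℂ | 1 < s.re} := by simpa using hσ
  have hev : ∀ᶠ z in 𝓝[≠] (σ : ℂ), F z ≠ 0 := by
    refine (hFan σ hσm).eventually_eq_zero_or_eventually_ne_zero.resolve_left fun hz => ?_
    have hall := hFan.eqOn_zero_of_preconnected_of_eventuallyEq_zero hconv.isPreconnected hσm hz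
    have hreal : (fun y : ℝ => F y) =ᶠ[atTop] 0 := by
      filter_upwards [eventually_gt_atTop 1] with y hy
      exact hall (by simpa using hy)
    have := (LSeries_eventually_eq_zero_iff'.1 hreal).resolve_right
      ((habs hdu).trans_lt (EReal.coe_lt_top 1)).ne
    exact hdz fun n hn => (mul_eq_zero.1 (this n hn)).resolve_right (Circle.coe_ne_zero _)
  rw [eventually_nhdsWithin_iff, Metric.eventually_nhds_iff] at hev
  obtain ⟨δ, hδ, hne⟩ := hev
  set r := min (δ / 2) ((σ - 1) / 2) with hrdef
  have hr : 0 < r := lt_min (by linarith) (by linarith)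
  have hrδ : r < δ := (min_le_left _ _).trans_lt (by linarith)
  have hrσ : r ≤ (σ - 1) / 2 := min_le_right _ _
  have hre : ∀ z ∈ closedBall (σ : ℂ) r, (σ + 1) / 2 ≤ z.re := by
    intro z hz
    have h1 := (abs_re_le_norm (z - σ)).trans (mem_closedBall_iff_norm.1 hz)
    have h2 := (abs_le.1 h1).1
    simp only [sub_re, ofReal_re] at h2
    linarith
  have hsub : closedBall (σ : ℂ) r ⊆ {s : ℂ | 1 < s.re} := fun z hz => by
    have := hre z hz
    show 1 < z.re
    linarith
  obtain ⟨w, hw, hmin⟩ := (isCompact_sphere (σ : ℂ) r).exists_isMinOn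
    (NormedSpace.sphere_nonempty.2 hr.le)
    ((hFan.continuousOn.mono (sphere_subset_closedBall.trans hsub)).norm)
  have hFw : 0 < ‖F w‖ := by
    refine norm_pos_iff.2 (hne (by rw [mem_sphere.1 hw]; exact hrδ) ?_)
    exact ne_of_mem_sphere hw hr.ne'
  obtain ⟨τ, hτ, hτp⟩ := exists_tendsto_prime_cpow u
  have hevj := eventually_forall_norm_shift_sub_twist_lt (d := d) (x := (σ + 1) / 2)
    (hd _ (by rw [ofReal_re]; linarith)) hτp (ε := ‖F w‖ / 4) (by positivity)
  intro hfin
  obtain ⟨M, hM⟩ := (hfin.image Complex.im).bddAbove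
  obtain ⟨j, hj, hjM⟩ := (hevj.and (hτ.eventually_gt_atTop (M + r))).exists
  have hmaps : ∀ z ∈ closedBall (σ : ℂ) r, 1 < (z + τ j * I).re := fun z hz => by
    simpa using hsub hz
  obtain ⟨z, hz, hz0⟩ := exists_zero_of_forall_norm_sub_lt (F := F)
    (G := fun z => LSeries d (z + τ j * I)) hr hFw (by
      refine DifferentiableOn.diffContOnCl_ball (U := closedBall (σ : ℂ) r) ?_ le_rfl
      intro z hz
      refine DifferentiableAt.differentiableWithinAt ?_
      exact DifferentiableAt.comp (g := LSeries d) (f := fun z => z + τ j * I) z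
        ((hH hd) _ (hmaps z hz)).differentiableAt (by fun_prop)) h0
    (fun z hz => hmin hz) (fun z hz => hj z (hre z hz))
  have := hM ⟨z + τ j * I, ⟨hmaps z hz, hz0⟩, rfl⟩
  have h1 := (abs_im_le_norm (z - σ)).trans (mem_closedBall_iff_norm.1 hz)
  have h2 := (abs_le.1 h1).1
  simp at this h2
  linarith

/-- A bounded nonnegative summable family has a choice of signs making its sum at most the
bound. -/
theorem exists_signs_abs_tsum_le {ι : Type*} [Countable ι] {r : ι → ℝ} {K : ℝ} (hK : 0 ≤ K)
    (hr0 : ∀ i, 0 ≤ r i) (hrK : ∀ i, r i ≤ K) (hr : Summable r) :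
    ∃ e : ι → ℝ, (∀ i, e i = 1 ∨ e i = -1) ∧ |∑' i, e i * r i| ≤ K := by
  obtain ⟨f, hf⟩ := Countable.exists_injective_nat ι
  set x : ℕ → ℝ := Function.extend f r 0 with hx
  have hx0 : ∀ n, 0 ≤ x n ∧ x n ≤ K := by
    intro n
    by_cases h : ∃ i, f i = n
    · obtain ⟨i, rfl⟩ := h
      rw [hx, hf.extend_apply]
      exact ⟨hr0 i, hrK i⟩
    · rw [hx, Function.extend_apply' _ _ _ h]
      exact ⟨le_rfl, hK⟩
  -- the greedy choice of signs
  let S : ℕ → ℝ := fun n => Nat.rec (motive := fun _ => ℝ) 0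
    (fun n s => s + (if 0 < s then (-1 : ℝ) else 1) * x n) n
  let ε : ℕ → ℝ := fun n => if 0 < S n then (-1 : ℝ) else 1
  have hε : ∀ n, ε n = 1 ∨ ε n = -1 := fun n => by
    by_cases h : 0 < S n <;> simp [ε, h]
  have hS : ∀ n, S n = ∑ i ∈ Finset.range n, ε i * x i := by
    intro n
    induction n with
    | zero => rfl
    | succ n ih => rw [Finset.sum_range_succ, ← ih]
  have hbd : ∀ n, |S n| ≤ K := by
    intro n
    induction n with
    | zero => simpa [S] using hK
    | succ n ih =>
      have h1 : S (n + 1) = S n + ε n * x n := rfl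
      rw [h1]
      have h2 := abs_le.1 ih
      have h3 := hx0 n
      by_cases h : 0 < S n
      · simp only [ε, h, if_true]
        exact abs_le.2 ⟨by linarith, by linarith⟩
      · simp only [ε, h, if_false]
        exact abs_le.2 ⟨by linarith, by linarith⟩
  refine ⟨fun i => ε (f i), fun i => hε _, ?_⟩
  have hsum : Summable fun i => ε (f i) * r i := by
    refine Summable.of_norm_bounded hr fun i => ?_
    rw [norm_mul, Real.norm_of_nonneg (hr0 i)]
    rcases hε (f i) with h | h <;> simp [h]
  have hext : (fun n => ε n * x n) = Function.extend f (fun i => ε (f i) * r i) 0 := by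
    funext n
    by_cases h : ∃ i, f i = n
    · obtain ⟨i, rfl⟩ := h
      rw [hx, hf.extend_apply, hf.extend_apply]
    · rw [hx, Function.extend_apply' _ _ _ h, Function.extend_apply' _ _ _ h]
      simp
  have hlim : Tendsto S atTop (nhds (∑' i, ε (f i) * r i)) := by
    have h1 : HasSum (fun n => ε n * x n) (∑' i, ε (f i) * r i) := by
      rw [hext, hasSum_extend_zero hf]
      exact hsum.hasSum
    exact h1.tendsto_sum_nat.congr fun n => (hS n).symm
  exact le_of_tendsto hlim.abs (Eventually.of_forall hbd)

/-- Up to a bounded error, a large disc is covered continuously by the sums `∑ r i * v i` with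
unimodular `v i`. -/
theorem exists_circle_family_norm_tsum_sub_le {ι : Type*} [Countable ι] {r : ι → ℝ} {K R : ℝ}
    (hK : 0 ≤ K) (hR : 0 < R) (hr0 : ∀ i, 0 ≤ r i) (hrK : ∀ i, r i ≤ K) (hr : Summable r)
    (hsum : 2 * R + K ≤ ∑' i, r i) :
    ∃ v : ℂ → ι → Circle, (∀ i, Continuous fun z => v z i) ∧
      ∀ z, ‖z‖ ≤ R → ‖∑' i, (r i : ℂ) * v z i - z‖ ≤ 2 * K := by
  classical
  obtain ⟨e, he, heK⟩ := exists_signs_abs_tsum_le hK hr0 hrK hr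
  have hesum : Summable fun i => e i * r i := by
    refine Summable.of_norm_bounded hr fun i => ?_
    rw [norm_mul, Real.norm_of_nonneg (hr0 i)]
    rcases he i with h | h <;> simp [h]
  -- half of the sum, for each of the two signs
  have key : ∀ δ : ℝ, (δ = 1 ∨ δ = -1) → ∃ (q ε : ι → ℝ) (S : ℝ), HasSum q S ∧ R ≤ S ∧
      (∀ i, q i = if e i = δ then r i else 0) ∧ (∀ i, ε i = 1 ∨ ε i = -1) ∧
      Summable (fun i => ε i * q i) ∧ |∑' i, ε i * q i| ≤ K := by
    intro δ hδ
    let q : ι → ℝ := fun i => if e i = δ then r i else 0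
    have hq : ∀ i, q i = 2⁻¹ * (r i + δ * (e i * r i)) := by
      intro i
      rcases he i with h | h <;> rcases hδ with h' | h' <;> simp only [q, h, h'] <;> norm_num <;>
        ring
    have hqs : HasSum q (2⁻¹ * (∑' i, r i + δ * ∑' i, e i * r i)) := by
      rw [funext hq]
      exact (hr.hasSum.add (hesum.hasSum.mul_left δ)).mul_left _
    have hq0 : ∀ i, 0 ≤ q i := fun i => by
      by_cases h : e i = δ <;> simp [q, h, hr0]
    have hqK : ∀ i, q i ≤ K := fun i => by
      by_cases h : e i = δ <;> simp [q, h, hrK, hK]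
    obtain ⟨ε, hε, hεK⟩ := exists_signs_abs_tsum_le hK hq0 hqK hqs.summable
    refine ⟨q, ε, _, hqs, ?_, fun i => rfl, hε, ?_, hεK⟩
    · have := abs_le.1 heK
      rcases hδ with h | h <;> rw [h] <;> linarith
    · refine Summable.of_norm_bounded hqs.summable fun i => ?_
      rw [norm_mul, Real.norm_of_nonneg (hq0 i)]
      rcases hε i with h | h <;> simp [h]
  obtain ⟨q₁, ε₁, S₁, hq₁, hS₁, hqe₁, hε₁, hs₁, hb₁⟩ := key 1 (Or.inl rfl)
  obtain ⟨q₂, ε₂, S₂, hq₂, hS₂, hqe₂, hε₂, hs₂, hb₂⟩ := key (-1) (Or.inr rfl)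
  have hexp : ∀ (ε α : ℝ), (ε = 1 ∨ ε = -1) →
      (Circle.exp (ε * α) : ℂ) = Real.cos α + ε * Real.sin α * I := by
    intro ε α h
    rw [Circle.coe_exp, exp_mul_I, ← ofReal_cos, ← ofReal_sin]
    rcases h with rfl | rfl <;> simp
  refine ⟨fun z i => if e i = 1 then Circle.exp (ε₁ i * Real.arccos (z.re / S₁))
    else Circle.exp (Real.pi / 2) * Circle.exp (ε₂ i * Real.arccos (z.im / S₂)), fun i => ?_,
    fun z hz => ?_⟩
  · by_cases h : e i = 1
    · simp only [h, if_true]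
      fun_prop
    · simp only [h, if_false]
      fun_prop
  set α := Real.arccos (z.re / S₁) with hα
  set β := Real.arccos (z.im / S₂) with hβ
  have hcos : ∀ {x S : ℝ}, |x| ≤ R → R ≤ S → S * Real.cos (Real.arccos (x / S)) = x := by
    intro x S hx hS
    have hS0 : 0 < S := hR.trans_le hS
    have := abs_le.1 hx
    rw [Real.cos_arccos, mul_div_cancel₀ _ hS0.ne']
    · rw [le_div_iff₀ hS0]; linarith
    · rw [div_le_one hS0]; linarith
  have hterm : ∀ i, (r i : ℂ) * ((if e i = 1 then Circle.exp (ε₁ i * α)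
      else Circle.exp (Real.pi / 2) * Circle.exp (ε₂ i * β) : Circle) : ℂ) =
      (q₁ i * Real.cos α + (ε₁ i * q₁ i : ℝ) * (Real.sin α * I)) +
        (q₂ i * Real.cos β + (ε₂ i * q₂ i : ℝ) * (Real.sin β * I)) * I := by
    intro i
    have hI : (Circle.exp (Real.pi / 2) : ℂ) = I := by
      rw [Circle.coe_exp, ofReal_div, ofReal_ofNat, exp_pi_div_two_mul_I]
    rcases he i with h | h
    · rw [if_pos h, hexp _ _ (hε₁ i), hqe₁, hqe₂, if_pos h, if_neg (by rw [h]; norm_num)]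
      push_cast
      ring
    · rw [if_neg (by rw [h]; norm_num), Circle.coe_mul, hI, hexp _ _ (hε₂ i), hqe₁, hqe₂,
        if_neg (by rw [h]; norm_num), if_pos h]
      push_cast
      ring
  have hS : HasSum (fun i => (q₁ i * Real.cos α + (ε₁ i * q₁ i : ℝ) * (Real.sin α * I)) +
        (q₂ i * Real.cos β + (ε₂ i * q₂ i : ℝ) * (Real.sin β * I)) * I)
      ((S₁ * Real.cos α + (∑' i, ε₁ i * q₁ i : ℝ) * (Real.sin α * I)) +
        (S₂ * Real.cos β + (∑' i, ε₂ i * q₂ i : ℝ) * (Real.sin β * I)) * I) :=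
    (((hasSum_ofReal.2 hq₁).mul_right _).add ((hasSum_ofReal.2 hs₁.hasSum).mul_right _)).add
      ((((hasSum_ofReal.2 hq₂).mul_right _).add
        ((hasSum_ofReal.2 hs₂.hasSum).mul_right _)).mul_right _)
  rw [tsum_congr hterm, hS.tsum_eq, ← ofReal_mul, ← ofReal_mul,
    hcos ((abs_re_le_norm z).trans hz) hS₁, hcos ((abs_im_le_norm z).trans hz) hS₂]
  set T₁ := ∑' i, ε₁ i * q₁ i
  set T₂ := ∑' i, ε₂ i * q₂ i
  have hsplit : (z.re + (T₁ : ℂ) * (Real.sin α * I)) + (z.im + (T₂ : ℂ) * (Real.sin β * I)) * I - z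
      = T₁ * (Real.sin α * I) + T₂ * (Real.sin β * I) * I := by
    linear_combination re_add_im z
  have hb : ∀ {T x : ℝ}, |T| ≤ K → ‖(T : ℂ) * (Real.sin x * I)‖ ≤ K := by
    intro T x hT
    rw [norm_mul, norm_mul, norm_I, mul_one, norm_real, norm_real]
    exact (mul_le_of_le_one_right (norm_nonneg _) (Real.abs_sin_le_one x)).trans hT
  rw [hsplit]
  refine (norm_add_le _ _).trans ?_
  rw [norm_mul (_ * _) I, norm_I, mul_one, two_mul]
  exact add_le_add (hb hb₁) (hb hb₂)

theorem Nat.Primes.summable_mul_geometric_of_lt {θ : ℝ} (hθ : θ < 1 / 2) :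
    Summable fun pk : Nat.Primes × ℕ =>
      ((pk.1 : ℕ) : ℝ) ^ (2 * (θ - 1)) * ((2 : ℝ) ^ (θ - 1)) ^ pk.2 := by
  refine Summable.mul_of_nonneg (f := fun p : Nat.Primes => ((p : ℕ) : ℝ) ^ (2 * (θ - 1)))
    (Nat.Primes.summable_rpow.2 (by linarith))
    (summable_geometric_of_lt_one (by positivity)
      (Real.rpow_lt_one_of_one_lt_of_neg one_lt_two (by linarith)))
    (fun p => by positivity) fun k => by positivity

/-- A bound, uniform in `σ > 1`, for the terms at proper prime powers. -/
theorem norm_mul_cpow_le_of_norm_le_rpow {β : ℂ} {K θ σ : ℝ} (hθ : θ < 1 / 2)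
    (hσ : 1 < σ) {p : ℕ} (hp : p.Prime) (k : ℕ)
    (hβ : ‖β‖ ≤ K * (p : ℝ) ^ (((k + 2 : ℕ) : ℝ) * θ)) :
    ‖β * (p : ℂ) ^ (-((k + 2 : ℕ) : ℂ) * σ)‖ ≤
      K * ((p : ℝ) ^ (2 * (θ - 1)) * ((2 : ℝ) ^ (θ - 1)) ^ k) := by
  have hp0 : (0 : ℝ) < p := by exact_mod_cast hp.pos
  have hp1 : (1 : ℝ) ≤ p := by exact_mod_cast hp.one_le
  have hp2 : (2 : ℝ) ≤ p := by exact_mod_cast hp.two_le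
  have hK : 0 ≤ K := nonneg_of_mul_nonneg_left ((norm_nonneg _).trans hβ) (by positivity)
  rw [norm_mul, norm_natCast_cpow_of_pos hp.pos]
  have hre : (-((k + 2 : ℕ) : ℂ) * σ).re = -((k + 2 : ℕ) : ℝ) * σ := by
    rw [← ofReal_natCast, ← ofReal_neg, ← ofReal_mul, ofReal_re]
  rw [hre]
  calc _ ≤ K * (p : ℝ) ^ (((k + 2 : ℕ) : ℝ) * θ) * (p : ℝ) ^ (-((k + 2 : ℕ) : ℝ) * σ) := by
        gcongr
    _ = K * (p : ℝ) ^ (((k + 2 : ℕ) : ℝ) * (θ - σ)) := by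
        rw [mul_assoc, ← Real.rpow_add hp0]
        ring_nf
    _ ≤ K * (p : ℝ) ^ (((k + 2 : ℕ) : ℝ) * (θ - 1)) := by
        gcongr
    _ = K * ((p : ℝ) ^ (2 * (θ - 1)) * ((p : ℝ) ^ (θ - 1)) ^ k) := by
        rw [← Real.rpow_mul_natCast hp0.le, ← Real.rpow_add hp0]
        push_cast
        ring_nf
    _ ≤ _ := by
        gcongr K * (_ * ?_ ^ k)
        exact Real.rpow_le_rpow_of_nonpos two_pos hp2 (by linarith)

/-- Twisting by a completely multiplicative function which is trivial at the small primes changes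
an absolutely convergent Dirichlet series only slightly. -/
theorem LSeries.exists_forall_norm_twist_sub_le {d : ℕ → ℂ} {x : ℝ} (hd : LSeriesSummable d x)
    {ε : ℝ} (hε : 0 < ε) :
    ∃ N : ℕ, ∀ u : ℕ → Circle, (∀ p ≤ N, u p = 1) → ∀ s : ℂ, x ≤ s.re →
      ‖LSeries (fun n => d n * Circle.twist u n) s - LSeries d s‖ ≤ ε := by
  have hg : Summable fun n => ‖LSeries.term d x n‖ := hd.norm
  obtain ⟨N, hN⟩ := ((tendsto_sum_nat_add fun n => ‖LSeries.term d x n‖).eventually_lt_const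
    (show (0 : ℝ) < ε / 2 by positivity)).exists
  refine ⟨N, fun u hu s hs => ?_⟩
  have hds : LSeriesSummable d s := hd.of_re_le_re (by simpa using hs)
  have h1 : HasSum (fun n => LSeries.term (fun n => d n * Circle.twist u n) s n -
      LSeries.term d s n) (LSeries (fun n => d n * Circle.twist u n) s - LSeries d s) :=
    (hds.mul_twist u).hasSum.sub hds.hasSum
  have h2 : HasSum (fun n => if n < N then 0 else 2 * ‖LSeries.term d x n‖)
      (2 * ∑' n, ‖LSeries.term d x (n + N)‖) := by
    rw [← hasSum_nat_add_iff' N, Finset.sum_eq_zero fun n hn => if_pos (Finset.mem_range.1 hn),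
      sub_zero]
    simpa using (((summable_nat_add_iff N).2 hg).hasSum.mul_left 2)
  rw [← h1.tsum_eq]
  refine (tsum_of_norm_bounded h2 fun n => ?_).trans (by linarith)
  have h3 : ‖LSeries.term d s n‖ ≤ ‖LSeries.term d x n‖ :=
    LSeries.norm_term_le_of_re_le_re d (by simpa using hs) n
  rw [LSeries.term_mul_right]
  split_ifs with h
  · rw [Circle.twist_eq_one hu h.le]
    simp
  · refine (norm_sub_le _ _).trans ?_
    rw [norm_mul, Circle.norm_coe, mul_one]
    linarith

theorem LSeries.continuous_twist {X : Type*} [TopologicalSpace X] {d : ℕ → ℂ} {s : ℂ}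
    (hd : LSeriesSummable d s) {u : X → ℕ → Circle} (hu : ∀ p, Continuous fun x => u x p) :
    Continuous fun x => LSeries (fun n => d n * Circle.twist (u x) n) s := by
  simp only [LSeries, LSeries.term_mul_right]
  refine continuous_tsum (fun n => ?_) hd.norm fun n x => ?_
  · exact continuous_const.mul (continuous_subtype_val.comp (Circle.continuous_twist hu n))
  · rw [norm_mul, Circle.norm_coe, mul_one]

theorem Circle.exists_mul_eq_norm (w : ℂ) : ∃ ω : Circle, w * ω = ‖w‖ := by
  refine ⟨Circle.exp (-arg w), ?_⟩
  nth_rw 1 [← norm_mul_exp_arg_mul_I w]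
  rw [Circle.coe_exp, mul_assoc, ← Complex.exp_add]
  simp

theorem Nat.Primes.summable_ite_le (f : ℕ → ℝ) (N : ℕ) :
    Summable fun p : Nat.Primes => if (p : ℕ) ≤ N then f p else 0 := by
  have h : {p : Nat.Primes | (p : ℕ) ≤ N}.Finite :=
    (Set.finite_Iic N).preimage Subtype.val_injective.injOn
  refine summable_of_hasFiniteSupport (h.subset fun p hp => ?_)
  by_contra hpN
  exact hp (if_neg hpN)

/-- The logarithms of the twisted Euler products, for twists which are trivial at the small
primes, cover a large disc continuously up to a bounded error. -/
theorem exists_circle_family_norm_log_euler_sub_le {b : ℕ → ℕ → ℂ} {K θ σ R : ℝ} (hK : 0 < K)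
    (hθ : θ < 1 / 2) (hσ : 1 < σ)
    (hsum : Summable (fun pk : Nat.Primes × ℕ =>
        ‖b pk.1 (pk.2 + 1) * ((pk.1 : ℕ) : ℂ) ^ (-(((pk.2 : ℕ) + 1 : ℕ) : ℂ) * σ)‖))
    (hbd : ∀ p : ℕ, p.Prime → ∀ k : ℕ, 1 ≤ k → ‖b p k‖ ≤ K * (p : ℝ) ^ ((k : ℝ) * θ))
    (N : ℕ) (hR : 0 < R)
    (hS : 2 * R + K + ∑' p : Nat.Primes, (if (p : ℕ) ≤ N then ‖b p 1‖ else 0) ≤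
      ∑' p : Nat.Primes, ‖b p 1‖ * ((p : ℕ) : ℝ) ^ (-σ)) :
    ∃ u : ℂ → ℕ → Circle, (∀ p, Continuous fun z => u z p) ∧ (∀ z, ∀ p ≤ N, u z p = 1) ∧
      ∀ z, ‖z‖ ≤ R → ‖∑' pk : Nat.Primes × ℕ, b pk.1 (pk.2 + 1) *
        ((pk.1 : ℕ) : ℂ) ^ (-(((pk.2 : ℕ) + 1 : ℕ) : ℂ) * σ) * (u z pk.1 : ℂ) ^ (pk.2 + 1) - z‖ ≤
        2 * K + (∑' p : Nat.Primes, (if (p : ℕ) ≤ N then ‖b p 1‖ else 0) +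
          K * ((2 : ℝ) ^ (θ - 1))⁻¹ * ∑' pk : Nat.Primes × ℕ,
            ((pk.1 : ℕ) : ℝ) ^ (2 * (θ - 1)) * ((2 : ℝ) ^ (θ - 1)) ^ pk.2) := by
  classical
  set q : Nat.Primes → ℝ := fun p => if (p : ℕ) ≤ N then ‖b p 1‖ else 0 with hq
  set T : Nat.Primes × ℕ → ℂ := fun pk => b pk.1 (pk.2 + 1) *
    ((pk.1 : ℕ) : ℂ) ^ (-(((pk.2 : ℕ) + 1 : ℕ) : ℂ) * σ) with hT
  set ρ : ℝ := (2 : ℝ) ^ (θ - 1) with hρ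
  have hρ0 : 0 < ρ := by positivity
  have hqs : Summable q := Nat.Primes.summable_ite_le (fun p => ‖b p 1‖) N
  have hT0 : ∀ p : Nat.Primes, T (p, 0) = b p 1 * (((p : ℕ) : ℝ) ^ (-σ) : ℝ) := by
    intro p
    rw [ofReal_cpow (Nat.cast_nonneg _)]
    simp [hT]
  have hT0n : ∀ p : Nat.Primes, ‖T (p, 0)‖ = ‖b p 1‖ * ((p : ℕ) : ℝ) ^ (-σ) := by
    intro p
    rw [hT0, norm_mul, norm_real, Real.norm_of_nonneg (by positivity)]
  have hinj : Function.Injective fun p : Nat.Primes => (p, 0) := fun p p' h => (Prod.ext_iff.1 h).1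
  have hfull : Summable fun p : Nat.Primes => ‖b p 1‖ * ((p : ℕ) : ℝ) ^ (-σ) :=
    (hsum.comp_injective hinj).congr hT0n
  have hp1 : ∀ p : Nat.Primes, ((p : ℕ) : ℝ) ^ (-σ) ≤ 1 := fun p =>
    Real.rpow_le_one_of_one_le_of_nonpos (by exact_mod_cast p.2.one_le) (by linarith)
  set r : Nat.Primes → ℝ := fun p =>
    if (p : ℕ) ≤ N then 0 else ‖b p 1‖ * ((p : ℕ) : ℝ) ^ (-σ) with hr
  have hr0 : ∀ p, 0 ≤ r p := fun p => by
    by_cases h : (p : ℕ) ≤ N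
    · simp [hr, h]
    · simp only [hr, h, if_false]
      positivity
  have hrf : ∀ p, r p ≤ ‖b p 1‖ * ((p : ℕ) : ℝ) ^ (-σ) := fun p => by
    by_cases h : (p : ℕ) ≤ N
    · simp only [hr, h, if_true]
      positivity
    · simp [hr, h]
  have hrK : ∀ p, r p ≤ K := by
    intro p
    have hp0 : (0 : ℝ) < (p : ℕ) := by exact_mod_cast p.2.pos
    calc r p ≤ ‖b p 1‖ * ((p : ℕ) : ℝ) ^ (-σ) := hrf p
      _ ≤ K * ((p : ℕ) : ℝ) ^ (((1 : ℕ) : ℝ) * θ) * ((p : ℕ) : ℝ) ^ (-σ) := by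
        gcongr
        exact hbd p p.2 1 le_rfl
      _ = K * ((p : ℕ) : ℝ) ^ (θ - σ) := by
        rw [mul_assoc, ← Real.rpow_add hp0]
        simp [sub_eq_add_neg]
      _ ≤ K := mul_le_of_le_one_right hK.le
        (Real.rpow_le_one_of_one_le_of_nonpos (by exact_mod_cast p.2.one_le) (by linarith))
  have hrs : Summable r := Summable.of_nonneg_of_le hr0 hrf hfull
  have hrsum : 2 * R + K ≤ ∑' p, r p := by
    have : ∑' p : Nat.Primes, ‖b p 1‖ * ((p : ℕ) : ℝ) ^ (-σ) ≤ ∑' p, q p + ∑' p, r p := by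
      rw [← hqs.tsum_add hrs]
      refine hfull.tsum_le_tsum (fun p => ?_) (hqs.add hrs)
      by_cases h : (p : ℕ) ≤ N
      · simp only [hq, hr, h, if_true, add_zero]
        exact mul_le_of_le_one_right (norm_nonneg _) (hp1 p)
      · simp [hq, hr, h]
    linarith
  obtain ⟨v, hv, hvz⟩ := exists_circle_family_norm_tsum_sub_le hK.le hR hr0 hrK hrs hrsum
  choose ω hω using fun p => Circle.exists_mul_eq_norm (b p 1)
  let u : ℂ → ℕ → Circle := fun z p => if h : p.Prime ∧ N < p then ω p * v z ⟨p, h.1⟩ else 1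
  have huN : ∀ z, ∀ p ≤ N, u z p = 1 := fun z p hp => dif_neg fun h => hp.not_gt h.2
  have hu : ∀ z, ∀ p : Nat.Primes, N < p → u z p = ω p * v z p := fun z p hp =>
    dif_pos ⟨p.2, hp⟩
  refine ⟨u, fun p => ?_, huN, fun z hz => ?_⟩
  · by_cases h : p.Prime ∧ N < p
    · simp only [u, h, and_self, dite_true]
      exact continuous_const.mul (hv _)
    · simp only [u, h, dite_false]
      exact continuous_const
  set m : Nat.Primes × ℕ → ℂ := fun pk => if pk.2 = 0 then (r pk.1 : ℂ) * v z pk.1 else 0 with hm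
  have hms : HasSum m (∑' p, (r p : ℂ) * v z p) := by
    refine (hinj.hasSum_iff fun pk hpk => ?_).1 ?_
    · refine if_neg fun h => hpk ⟨pk.1, ?_⟩
      rw [← h]
    · refine Summable.hasSum (Summable.of_norm_bounded hrs fun p => ?_)
      change ‖(r p : ℂ) * v z p‖ ≤ r p
      rw [norm_mul, Circle.norm_coe, mul_one, norm_real,
        Real.norm_of_nonneg (hr0 p)]
  have hTs : Summable fun pk : Nat.Primes × ℕ => T pk * (u z pk.1 : ℂ) ^ (pk.2 + 1) := by
    refine Summable.of_norm_bounded hsum fun pk => ?_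
    rw [norm_mul, norm_pow, Circle.norm_coe, one_pow, mul_one]
  set w : Nat.Primes × ℕ → ℝ := fun pk => ((pk.1 : ℕ) : ℝ) ^ (2 * (θ - 1)) * ρ ^ pk.2 with hw
  have hws : HasSum (fun pk : Nat.Primes × ℕ => (if pk.2 = 0 then q pk.1 else 0) +
      K * ρ⁻¹ * w pk) (∑' p, q p + K * ρ⁻¹ * ∑' pk, w pk) := by
    refine HasSum.add ((hinj.hasSum_iff fun pk hpk => ?_).1 ?_)
      ((Nat.Primes.summable_mul_geometric_of_lt hθ).hasSum.mul_left _)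
    · refine if_neg fun h => hpk ⟨pk.1, ?_⟩
      rw [← h]
    · exact hqs.hasSum
  have hdiff : ‖∑' pk : Nat.Primes × ℕ, T pk * (u z pk.1 : ℂ) ^ (pk.2 + 1) -
      ∑' p, (r p : ℂ) * v z p‖ ≤ ∑' p, q p + K * ρ⁻¹ * ∑' pk, w pk := by
    rw [← hms.tsum_eq, ← hTs.tsum_sub hms.summable]
    refine tsum_of_norm_bounded hws ?_
    rintro ⟨p, _ | k⟩
    · have hw0 : 0 ≤ K * ρ⁻¹ * w (p, 0) := by positivity
      refine le_add_of_le_of_nonneg ?_ hw0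
      by_cases h : (p : ℕ) ≤ N
      · simp only [hm, hq, hr, h, if_true, huN z p h]
        simpa [hT0n] using mul_le_of_le_one_right (norm_nonneg (b p 1)) (hp1 p)
      · simp only [hm, hq, hr, h, if_true, if_false, hu z p (not_le.1 h), hT0, zero_add, pow_one,
          Circle.coe_mul]
        refine (norm_eq_zero.2 ?_).le
        rw [ofReal_mul]
        linear_combination (((((p : ℕ) : ℝ) ^ (-σ) : ℝ) : ℂ) * v z p) * hω p
    · have h := norm_mul_cpow_le_of_norm_le_rpow hθ hσ p.2 k (hbd p p.2 (k + 2) (by omega))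
      simp only [hm, Nat.succ_ne_zero, if_false, sub_zero, zero_add]
      rw [norm_mul, norm_pow, Circle.norm_coe, one_pow, mul_one]
      refine h.trans (le_of_eq ?_)
      simp only [hw, pow_succ, ← hρ]
      field_simp
  calc _ = ‖(∑' pk : Nat.Primes × ℕ, T pk * (u z pk.1 : ℂ) ^ (pk.2 + 1) -
        ∑' p, (r p : ℂ) * v z p) + (∑' p, (r p : ℂ) * v z p - z)‖ := by
        congr 1
        ring
    _ ≤ _ := norm_add_le _ _
    _ ≤ (∑' p, q p + K * ρ⁻¹ * ∑' pk, w pk) + 2 * K := add_le_add hdiff (hvz z hz)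
    _ = _ := add_comm _ _


/-- **Theorem.** Let `L(s) = ∑ a(n) n^{-s}` satisfy hypotheses (I), (II), (III), and let
`f(s) = ∑ c(n) n^{-s}` be absolutely convergent for `Re s ≥ 1` with a uniformly bounded
(continuous) logarithm there. Then `L(s) + f(s)` has infinitely many zeros for `Re s > 1`. -/
theorem LSeries_add_bounded_log_infinite_zeros
    (a : ℕ → ℂ) (b : ℕ → ℕ → ℂ) (K θ : ℝ) (hK : 0 < K) (hθ : θ < 1 / 2)
    -- (I) absolute convergence for Re s > 1
    (hI : ∀ s : ℂ, 1 < s.re → LSeriesSummable a s)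
    -- (II) Euler product / logarithm: absolute convergence of the double series
    (hII_sum : ∀ s : ℂ, 1 < s.re →
      Summable (fun pk : Nat.Primes × ℕ =>
        ‖b pk.1 (pk.2 + 1) * ((pk.1 : ℕ) : ℂ) ^ (-(((pk.2 : ℕ) + 1 : ℕ) : ℂ) * s)‖))
    -- (II) exp of the double series equals L(s)
    (hII_exp : ∀ s : ℂ, 1 < s.re →
      Complex.exp (∑' pk : Nat.Primes × ℕ,
        b pk.1 (pk.2 + 1) * ((pk.1 : ℕ) : ℂ) ^ (-(((pk.2 : ℕ) + 1 : ℕ) : ℂ) * s)) = LSeries a s)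
    -- (II) bound on the coefficients b(p^k)
    (hII_bd : ∀ p : ℕ, p.Prime → ∀ k : ℕ, 1 ≤ k → ‖b p k‖ ≤ K * (p : ℝ) ^ ((k : ℝ) * θ))
    -- (III) the sum over primes of |a(p)| p^{-σ} tends to infinity as σ → 1⁺
    (hIII : Tendsto (fun σ : ℝ => ∑' p : Nat.Primes, ‖a (p : ℕ)‖ * ((p : ℕ) : ℝ) ^ (-σ))
      (nhdsWithin 1 (Set.Ioi 1)) atTop)
    -- the Dirichlet series f(s) = ∑ c(n) n^{-s} converges absolutely for Re s ≥ 1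
    (c : ℕ → ℂ) (hc : ∀ s : ℂ, 1 ≤ s.re → LSeriesSummable c s)
    -- f has a uniformly bounded continuous logarithm on Re s ≥ 1
    (B : ℝ) (hB : 0 < B) (g : ℂ → ℂ)
    (hg_cont : ContinuousOn g {s : ℂ | 1 ≤ s.re})
    (hg_exp : ∀ s : ℂ, 1 ≤ s.re → Complex.exp (g s) = LSeries c s)
    (hg_bd : ∀ s : ℂ, 1 ≤ s.re → ‖g s‖ ≤ B) :
    {s : ℂ | 1 < s.re ∧ LSeries a s + LSeries c s = 0}.Infinite := by
  obtain ⟨N, hN⟩ := LSeries.exists_forall_norm_twist_sub_le (d := c) (x := 1)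
    (hc _ (by simp)) (ε := Real.exp (-B) / 2) (by positivity)
  set C : ℝ := ∑' p : Nat.Primes, (if (p : ℕ) ≤ N then ‖b p 1‖ else 0) with hC
  set M : ℝ := 2 * K + (C + K * ((2 : ℝ) ^ (θ - 1))⁻¹ * ∑' pk : Nat.Primes × ℕ,
    ((pk.1 : ℕ) : ℝ) ^ (2 * (θ - 1)) * ((2 : ℝ) ^ (θ - 1)) ^ pk.2) with hM
  have hC0 : 0 ≤ C := tsum_nonneg fun p => by split_ifs <;> positivity
  have hM0 : 0 ≤ M := by positivity
  set R : ℝ := M + Real.pi + B + 2 with hR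
  have hR0 : 0 < R := by positivity
  obtain ⟨σ, hσS, hσ⟩ : ∃ σ : ℝ, 2 * R + K + C ≤
      ∑' p : Nat.Primes, ‖b p 1‖ * ((p : ℕ) : ℝ) ^ (-σ) ∧ 1 < σ := by
    obtain ⟨σ, hσ, hσ1⟩ := ((hIII.eventually_gt_atTop (‖a 1‖ * (2 * R + K + C))).and
      self_mem_nhdsWithin).exists
    refine ⟨σ, (lt_of_mul_lt_mul_left (hσ.trans_eq ?_) (norm_nonneg (a 1))).le, hσ1⟩
    rw [← tsum_mul_left]
    refine tsum_congr fun p => ?_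
    rw [LSeries.apply_prime_of_exp_tsum_eq hI hII_sum hII_exp p.2, norm_mul, mul_assoc]
  have hσre : 1 < (σ : ℂ).re := by simpa using hσ
  obtain ⟨u, huc, huN, hu⟩ := exists_circle_family_norm_log_euler_sub_le hK hθ hσ
    (hII_sum σ hσre) hII_bd N hR0 hσS
  set D : ℂ → ℂ := fun z => ∑' pk : Nat.Primes × ℕ, b pk.1 (pk.2 + 1) *
    ((pk.1 : ℕ) : ℂ) ^ (-(((pk.2 : ℕ) + 1 : ℕ) : ℂ) * σ) * (u z pk.1 : ℂ) ^ (pk.2 + 1) with hD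
  have hDc : Continuous D := by
    refine continuous_tsum (fun pk => ?_) (hII_sum σ hσre) fun pk z => ?_
    · exact continuous_const.mul ((continuous_subtype_val.comp (huc _)).pow _)
    · rw [norm_mul, norm_pow, Circle.norm_coe, one_pow, mul_one]
  set F : ℂ → ℂ := fun z => LSeries (fun n => c n * Circle.twist (u z) n) σ with hF
  have hFc : Continuous F := LSeries.continuous_twist (hc σ hσre.le) huc
  set f : ℂ := LSeries c σ with hf
  have hfexp : exp (g σ) = f := hg_exp σ hσre.le
  have hf0 : f ≠ 0 := hfexp ▸ exp_ne_zero _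
  have hfB : Real.exp (-B) ≤ ‖f‖ := by
    rw [← hfexp, norm_exp]
    exact Real.exp_le_exp.2 (abs_le.1 ((abs_re_le_norm _).trans (hg_bd σ hσre.le))).1
  have hq : ∀ z, ‖F z / f - 1‖ ≤ 1 / 2 := by
    intro z
    rw [div_sub_one hf0, norm_div, div_le_iff₀ (norm_pos_iff.2 hf0)]
    linarith [hN (u z) (huN z) σ hσre.le]
  have hslit : ∀ z, F z / f ∈ slitPlane := by
    intro z
    have := mem_slitPlane_of_norm_lt_one ((hq z).trans_lt one_half_lt_one)
    rwa [add_sub_cancel] at this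
  have hlog : ∀ z, ‖log (F z / f)‖ ≤ 1 := by
    intro z
    have := norm_log_one_add_half_le_self (hq z)
    rw [add_sub_cancel] at this
    linarith [hq z]
  -- a zero of `φ` gives a twist for which the two Dirichlet series cancel
  set φ : ℂ → ℂ := fun z => D z - (Real.pi * I + g σ + log (F z / f)) with hφ
  have hφc : Continuous φ :=
    hDc.sub (continuous_const.add ((hFc.div_const f).clog hslit))
  obtain ⟨z, -, hz⟩ := exists_zero_of_norm_sub_lt hR0 hφc fun z hz => by
    have h1 : ‖D z - z‖ ≤ M := hu z hz.le
    have h2 : ‖(Real.pi : ℂ) * I‖ = Real.pi := by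
      rw [norm_mul, norm_I, mul_one, norm_real, Real.norm_of_nonneg Real.pi_pos.le]
    calc ‖φ z - z‖ = ‖(D z - z) - (Real.pi * I + g σ + log (F z / f))‖ := by
          congr 1
          simp only [hφ]
          ring
      _ ≤ ‖D z - z‖ + (‖(Real.pi : ℂ) * I‖ + ‖g σ‖ + ‖log (F z / f)‖) :=
          (norm_sub_le _ _).trans (add_le_add_right (norm_add₃_le ..) _)
      _ < R := by linarith [hlog z, hg_bd σ hσre.le]
  have hcancel : LSeries (fun n => a n * Circle.twist (u z) n) σ = -F z := by
    rw [← LSeries.exp_tsum_twist hI hII_sum hII_exp (u z) hσ, show (∑' pk : Nat.Primes × ℕ, _) = D z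
      from rfl, sub_eq_zero.1 hz, exp_add, exp_add, exp_pi_mul_I, hfexp,
      exp_log (slitPlane_ne_zero (hslit z)), neg_one_mul, neg_mul, mul_div_cancel₀ _ hf0]
  have hac : ∀ s : ℂ, 1 < s.re → LSeriesSummable (a + c) s := fun s hs =>
    (hI s hs).add (hc s hs.le)
  refine (LSeries.infinite_zeros_of_twist_zero hac (u z) hσ ?_).mono ?_
  · have hadd : (fun n => (a + c) n * (Circle.twist (u z) n : ℂ)) =
        (fun n => a n * (Circle.twist (u z) n : ℂ)) + fun n => c n * (Circle.twist (u z) n : ℂ) :=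
      funext fun n => add_mul _ _ _
    rw [hadd, LSeries_add ((hI σ hσre).mul_twist _) ((hc σ hσre.le).mul_twist _), hcancel]
    exact neg_add_cancel _
  · rintro s ⟨hs, hs0⟩
    exact ⟨hs, by rw [← LSeries_add (hI s hs) (hc s hs.le), hs0]⟩
end

section
/- Let L(s) = Σ_{n≥1} a(n) n^{-s} be a Dirichlet series satisfying hypotheses (I) and (II) (with constants K > 0 and θ < 1/2 from (II)). Then for every ε > 0 there exists a constant C_ε > 0 such that |a(n)| ≤ C_ε n^{θ+ε} for every integer n ≥ 2. -/
open Complex Filter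

/-- The Taylor coefficients at `0` of `exp (∑ γ k x ^ (k + 1))`. -/
noncomputable def expCoeff (γ : ℕ → ℂ) (n : ℕ) : ℂ :=
  (n.factorial : ℂ)⁻¹ * iteratedDeriv n (fun x : ℂ => exp (∑' k, γ k * x ^ (k + 1))) 0

lemma expCoeff_zero (γ : ℕ → ℂ) : expCoeff γ 0 = 1 := by
  simp [expCoeff]

section SinglePrime

variable {γ : ℕ → ℂ} {K ρ : ℝ}

lemma norm_mul_pow_succ_le (hK : 0 < K) (hρ : 0 < ρ) (hγ : ∀ k, ‖γ k‖ ≤ K * ρ ^ (k + 1))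
    {R : ℝ} {x : ℂ} (hx : ‖x‖ ≤ R / ρ) (k : ℕ) :
    ‖γ k * x ^ (k + 1)‖ ≤ K * R * R ^ k := by
  calc ‖γ k * x ^ (k + 1)‖ = ‖γ k‖ * ‖x‖ ^ (k + 1) := by rw [norm_mul, norm_pow]
    _ ≤ (K * ρ ^ (k + 1)) * (R / ρ) ^ (k + 1) := by gcongr; exact hγ k
    _ = K * R * R ^ k := by rw [mul_assoc, ← mul_pow, mul_div_cancel₀ _ hρ.ne']; ring

lemma differentiableOn_exp_tsum (hK : 0 < K) (hρ : 0 < ρ)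
    (hγ : ∀ k, ‖γ k‖ ≤ K * ρ ^ (k + 1)) {R : ℝ} (hR0 : 0 < R) (hR1 : R < 1) :
    DifferentiableOn ℂ (fun x : ℂ => exp (∑' k, γ k * x ^ (k + 1)))
      (Metric.ball 0 (R / ρ)) := by
  refine DifferentiableOn.cexp (differentiableOn_tsum_of_summable_norm
    ((summable_geometric_of_lt_one hR0.le hR1).mul_left (K * R)) (fun k => by fun_prop)
    Metric.isOpen_ball fun k x hx => norm_mul_pow_succ_le hK hρ hγ ?_ k)
  simpa using (mem_ball_zero_iff.mp hx).le

lemma hasSum_expCoeff (hK : 0 < K) (hρ : 0 < ρ) (hγ : ∀ k, ‖γ k‖ ≤ K * ρ ^ (k + 1))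
    {x : ℂ} (hx : ‖x‖ * ρ < 1) :
    HasSum (fun n => expCoeff γ n * x ^ n) (exp (∑' k, γ k * x ^ (k + 1))) := by
  obtain ⟨R, hxR, hR1⟩ := exists_between hx
  have hR0 : 0 < R := lt_of_le_of_lt (by positivity) hxR
  have h := hasSum_taylorSeries_on_ball (differentiableOn_exp_tsum hK hρ hγ hR0 hR1)
    (z := x) (by rwa [mem_ball_zero_iff, lt_div_iff₀ hρ])
  have hterm (n : ℕ) : expCoeff γ n * x ^ n = (n.factorial : ℂ)⁻¹ • (x - 0) ^ n •
      iteratedDeriv n (fun x : ℂ => exp (∑' k, γ k * x ^ (k + 1))) 0 := by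
    simp only [expCoeff, sub_zero, smul_eq_mul]
    ring
  exact (funext hterm) ▸ h

lemma norm_expCoeff_le (hK : 0 < K) (hρ : 0 < ρ) (hγ : ∀ k, ‖γ k‖ ≤ K * ρ ^ (k + 1))
    {R : ℝ} (hR0 : 0 < R) (hR1 : R < 1) (n : ℕ) :
    ‖expCoeff γ n‖ ≤ Real.exp (K * R * (1 - R)⁻¹) * (ρ / R) ^ n := by
  obtain ⟨R', hRR', hR'1⟩ := exists_between hR1
  have hdiff : DiffContOnCl ℂ (fun x : ℂ => exp (∑' k, γ k * x ^ (k + 1)))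
      (Metric.ball 0 (R / ρ)) := by
    refine ((differentiableOn_exp_tsum hK hρ hγ (hR0.trans hRR') hR'1).mono ?_).diffContOnCl
    exact Metric.closure_ball_subset_closedBall.trans
      (Metric.closedBall_subset_ball (by gcongr))
  have h := norm_iteratedDeriv_le_of_forall_mem_sphere_norm_le n (by positivity) hdiff
    (C := Real.exp (K * R * (1 - R)⁻¹)) fun x hx => by
      refine (norm_exp_le_exp_norm _).trans (Real.exp_le_exp.mpr ?_)
      exact tsum_of_norm_bounded ((hasSum_geometric_of_lt_one hR0.le hR1).mul_left (K * R))
        (norm_mul_pow_succ_le hK hρ hγ (mem_sphere_zero_iff_norm.mp hx).le)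
  have hn : (0 : ℝ) < n.factorial := by exact_mod_cast n.factorial_pos
  rw [expCoeff, norm_mul, norm_inv, norm_natCast, inv_mul_le_iff₀ hn]
  refine h.trans_eq ?_
  rw [div_pow, div_pow]
  field_simp

end SinglePrime

section Multiplicative

variable {α : ℕ → ℕ → ℂ}

lemma norm_factorization_prod_le {D η : ℝ} {P : ℕ} (hD : 1 ≤ D)
    (hsmall : ∀ p, p.Prime → ∀ k, ‖α p k‖ ≤ D * ((p : ℝ) ^ η) ^ k)
    (hlarge : ∀ p, p.Prime → P ≤ p → ∀ k, 1 ≤ k → ‖α p k‖ ≤ ((p : ℝ) ^ η) ^ k)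
    {n : ℕ} (hn : n ≠ 0) : ‖n.factorization.prod α‖ ≤ D ^ P * (n : ℝ) ^ η := by
  have hpow : (n : ℝ) ^ η = ∏ p ∈ n.primeFactors, ((p : ℝ) ^ η) ^ n.factorization p := by
    rw [Nat.multiplicative_factorization (fun m : ℕ => (m : ℝ) ^ η)
      (fun x y _ => by
        rw [Nat.cast_mul, Real.mul_rpow (Nat.cast_nonneg x) (Nat.cast_nonneg y)])
      (by simp) hn, Nat.prod_factorization_eq_prod_primeFactors]
    refine Finset.prod_congr rfl fun p _ => ?_
    rw [Nat.cast_pow, ← Real.rpow_natCast, ← Real.rpow_mul (Nat.cast_nonneg p), mul_comm,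
      Real.rpow_mul (Nat.cast_nonneg p), Real.rpow_natCast]
  have hcard : (n.primeFactors.filter (· < P)).card ≤ P := by
    simpa using Finset.card_le_card (t := Finset.range P)
      (fun p hp => Finset.mem_range.mpr (Finset.mem_filter.mp hp).2)
  calc ‖n.factorization.prod α‖ = ∏ p ∈ n.primeFactors, ‖α p (n.factorization p)‖ := by
        rw [Nat.prod_factorization_eq_prod_primeFactors, norm_prod]
    _ ≤ ∏ p ∈ n.primeFactors,
          ((if p < P then D else 1) * ((p : ℝ) ^ η) ^ n.factorization p) := by
        refine Finset.prod_le_prod (fun _ _ => norm_nonneg _) fun p hp => ?_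
        have hpp := Nat.prime_of_mem_primeFactors hp
        split_ifs with h
        · exact hsmall p hpp _
        · rw [one_mul]
          exact hlarge p hpp (not_lt.mp h) _
            (hpp.factorization_pos_of_dvd hn (Nat.dvd_of_mem_primeFactors hp))
    _ = D ^ (n.primeFactors.filter (· < P)).card * (n : ℝ) ^ η := by
        rw [Finset.prod_mul_distrib, ← hpow, ← Finset.prod_filter, Finset.prod_const]
    _ ≤ D ^ P * (n : ℝ) ^ η := by gcongr

lemma hasProd_LSeries_factorization_prod (hα : ∀ p, α p 0 = 1) {s : ℂ}
    (hs : LSeriesSummable (fun n => n.factorization.prod α) s) :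
    HasProd (fun p : Nat.Primes => ∑' k, α p k * (((p : ℕ) : ℂ) ^ (-s)) ^ k)
      (LSeries (fun n => n.factorization.prod α) s) := by
  have h := EulerProduct.eulerProduct_hasProd
    (f := LSeries.term (fun n => n.factorization.prod α) s)
    (by simp) ?_ hs.norm (by simp)
  · rw [LSeries]
    convert h using 2 with p
    refine tsum_congr fun k => ?_
    have hp := p.2
    rw [LSeries.term_of_ne_zero (pow_ne_zero k hp.ne_zero), hp.factorization_pow,
      Finsupp.prod_single_index (hα _), Nat.cast_pow, ← natCast_cpow_natCast_mul, cpow_neg,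
      inv_pow, ← cpow_nat_mul, div_eq_mul_inv]
  · intro m n hmn
    rcases eq_or_ne m 0 with rfl | hm
    · simp
    rcases eq_or_ne n 0 with rfl | hn
    · simp
    rw [LSeries.term_of_ne_zero hm, LSeries.term_of_ne_zero hn,
      LSeries.term_of_ne_zero (mul_ne_zero hm hn), Nat.factorization_mul_of_coprime hmn,
      Finsupp.prod_add_index_of_disjoint
        (by simpa [Nat.support_factorization] using hmn.disjoint_primeFactors),
      Nat.cast_mul, natCast_mul_natCast_cpow, mul_div_mul_comm]

end Multiplicative

/-- Under hypotheses (I) and (II), for every `ε > 0` there is `C_ε > 0` with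
`|a(n)| ≤ C_ε n^{θ+ε}` for every `n ≥ 2`. -/
theorem coeff_bound_of_euler_product
    (a : ℕ → ℂ) (b : ℕ → ℕ → ℂ) (K θ : ℝ) (hK : 0 < K) (hθ : θ < 1 / 2)
    -- (I) absolute convergence for Re s > 1
    (hI : ∀ s : ℂ, 1 < s.re → LSeriesSummable a s)
    -- (II) Euler product / logarithm: absolute convergence of the double series
    (hII_sum : ∀ s : ℂ, 1 < s.re →
      Summable (fun pk : Nat.Primes × ℕ =>
        ‖b pk.1 (pk.2 + 1) * ((pk.1 : ℕ) : ℂ) ^ (-(((pk.2 : ℕ) + 1 : ℕ) : ℂ) * s)‖))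
    -- (II) exp of the double series equals L(s)
    (hII_exp : ∀ s : ℂ, 1 < s.re →
      Complex.exp (∑' pk : Nat.Primes × ℕ,
        b pk.1 (pk.2 + 1) * ((pk.1 : ℕ) : ℂ) ^ (-(((pk.2 : ℕ) + 1 : ℕ) : ℂ) * s)) = LSeries a s)
    -- (II) bound on the coefficients b(p^k)
    (hII_bd : ∀ p : ℕ, p.Prime → ∀ k : ℕ, 1 ≤ k → ‖b p k‖ ≤ K * (p : ℝ) ^ ((k : ℝ) * θ)) :
    ∀ ε : ℝ, 0 < ε → ∃ C : ℝ, 0 < C ∧ ∀ n : ℕ, 2 ≤ n → ‖a n‖ ≤ C * (n : ℝ) ^ (θ + ε) := by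
  intro ε hε
  let α : ℕ → ℕ → ℂ := fun p => expCoeff fun k => b p (k + 1)
  have hρ (p : ℕ) (hp : p.Prime) : 0 < (p : ℝ) ^ θ :=
    Real.rpow_pos_of_pos (by exact_mod_cast hp.pos) θ
  have hb (p : ℕ) (hp : p.Prime) (k : ℕ) : ‖b p (k + 1)‖ ≤ K * ((p : ℝ) ^ θ) ^ (k + 1) := by
    refine (hII_bd p hp (k + 1) k.succ_pos).trans_eq ?_
    rw [mul_comm _ θ, Real.rpow_mul (Nat.cast_nonneg p), Real.rpow_natCast]
  obtain ⟨C, hC, hbound⟩ : ∃ C : ℝ, 0 < C ∧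
      ∀ n : ℕ, n ≠ 0 → ‖n.factorization.prod α‖ ≤ C * (n : ℝ) ^ (θ + ε) := by
    have h2 : (1 : ℝ) < 2 ^ ε := Real.one_lt_rpow one_lt_two hε
    obtain ⟨P, hP⟩ := eventually_atTop.mp
      (((tendsto_rpow_atTop hε).comp tendsto_natCast_atTop_atTop).eventually_ge_atTop
        (2 * Real.exp K))
    have hR1 : ((2 : ℝ) ^ ε)⁻¹ < 1 := inv_lt_one_of_one_lt₀ h2
    have hD : 1 ≤ Real.exp (K * ((2 : ℝ) ^ ε)⁻¹ * (1 - ((2 : ℝ) ^ ε)⁻¹)⁻¹) :=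
      Real.one_le_exp (mul_nonneg (by positivity) (inv_nonneg.mpr (sub_nonneg.mpr hR1.le)))
    refine ⟨_, by positivity, fun n hn =>
      norm_factorization_prod_le (P := P) hD (fun p hp k => ?_) (fun p hp hPp k hk => ?_) hn⟩
    · have hp0 : (0 : ℝ) < p := by exact_mod_cast hp.pos
      have hp2 : (2 : ℝ) ≤ p := by exact_mod_cast hp.two_le
      refine (norm_expCoeff_le hK (hρ p hp) (hb p hp) (by positivity) hR1 k).trans ?_
      rw [div_inv_eq_mul, Real.rpow_add hp0]
      gcongr
    · have hp0 : (0 : ℝ) < p := by exact_mod_cast hp.pos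
      have hPp' : 2 * Real.exp K ≤ (p : ℝ) ^ ε := hP p hPp
      have h := norm_expCoeff_le hK (hρ p hp) (hb p hp) (R := 1 / 2) (by norm_num)
        (by norm_num) k
      calc ‖α p k‖ ≤ Real.exp K * ((p : ℝ) ^ θ / (1 / 2)) ^ k := by
            rwa [show K * (1 / 2) * (1 - 1 / 2)⁻¹ = K by ring] at h
        _ ≤ Real.exp K ^ k * ((p : ℝ) ^ θ / (1 / 2)) ^ k := by
            gcongr
            exact le_self_pow₀ (Real.one_le_exp hK.le) (by lia)
        _ = ((p : ℝ) ^ θ * (2 * Real.exp K)) ^ k := by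
            rw [← mul_pow]
            ring
        _ ≤ ((p : ℝ) ^ (θ + ε)) ^ k := by
            rw [Real.rpow_add hp0]
            gcongr
  refine ⟨C, hC, fun n hn => ?_⟩
  have hn0 : n ≠ 0 := by lia
  suffices a n = n.factorization.prod α from this ▸ hbound n hn0
  refine LSeries.eq_of_LSeries_eventually_eq (g := fun n => n.factorization.prod α)
    ?_ ?_ ?_ hn0
  · exact (hI 2 (by norm_num)).abscissaOfAbsConv_le.trans_lt (EReal.coe_lt_top _)
  · exact (LSeries.abscissaOfAbsConv_le_of_le_const_mul_rpow ⟨C, hbound⟩).trans_lt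
      (by exact_mod_cast EReal.coe_lt_top (θ + ε + 1))
  filter_upwards [eventually_gt_atTop (max 1 (θ + ε + 1))] with x hx
  have hx1 : 1 < (x : ℂ).re := (le_max_left _ _).trans_lt hx
  have hxθ : θ + ε + 1 < x := (le_max_right _ _).trans_lt hx
  rw [← hII_exp x hx1]
  have hprod := hasProd_LSeries_factorization_prod (α := α) (s := x)
    (fun p => expCoeff_zero _)
    (LSeriesSummable_of_le_const_mul_rpow (x := θ + ε + 1) (by simpa using hxθ)
      ⟨C, by simpa using hbound⟩)
  have hsum := (hII_sum x hx1).of_norm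
  have hexp := (hsum.hasSum.prod_fiberwise fun p => (hsum.prod_factor p).hasSum).cexp
  refine hexp.unique ?_
  convert hprod using 2 with p
  have hp0 : (0 : ℝ) < (p : ℕ) := by exact_mod_cast p.2.pos
  have hsmall : ‖((p : ℕ) : ℂ) ^ (-(x : ℂ))‖ * ((p : ℕ) : ℝ) ^ θ < 1 := by
    rw [norm_natCast_cpow_of_pos p.2.pos, ← Real.rpow_add hp0]
    refine Real.rpow_lt_one_of_one_lt_of_neg (by exact_mod_cast p.2.one_lt) ?_
    simp only [neg_re, ofReal_re]
    linarith
  rw [(hasSum_expCoeff hK (hρ p p.2) (hb p p.2) hsmall).tsum_eq, Function.comp_apply]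
  simp_rw [← cpow_nat_mul, neg_mul, mul_neg]
end
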